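/- arXiv:2110.13949 — 6 statements merged into one kernel-verified Lean document; each statement's English description precedes it below -/
import Mathlib

section
/- Let ε be an edge-weight function and υ a vertex-weight function on a finite set V with n = |V|. For every integer k with 0 ≤ k ≤ n, the coefficient of t^k in the polynomial det(t·W(υ) − L(ε)) equals (−1)^{n−k} times the sum, over all spanning forests F of G(ε) whose spanning subgraph (V, F) has exactly k connected components, of the weight w(F) = (∏_{{u,v} ∈ F} ε(u,v)) · ∏_{c} (∑_{v ∈ c} υ(v)), where the last product runs over the connected components c of the spanning subgraph (V, F). -/
open Matrix Polynomial
open scoped Classical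

/-- The combinatorial Laplacian of an edge-weight function. -/
noncomputable def lapMat {V : Type} [Fintype V] [DecidableEq V] (ε : V → V → ℝ) :
    Matrix V V ℝ :=
  Matrix.diagonal (fun v => ∑ u, ε v u) - Matrix.of ε

/-- The polynomial `det (t • W(υ) - L(ε))`. -/
noncomputable def Ppoly {V : Type} [Fintype V] [DecidableEq V]
    (ε : V → V → ℝ) (υ : V → ℝ) : Polynomial ℝ :=
  Matrix.det (Matrix.of fun u v =>
    Polynomial.X * Polynomial.C (Matrix.diagonal υ u v)
      - Polynomial.C (lapMat ε u v))

/-- The matrix whose rows indexed by `F` are those of `G` and whose other rows are those of the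
identity; its determinant is the principal minor of `G` on `F`. -/
def rowMix {E : Type*} [DecidableEq E] (G : Matrix E E ℝ) (F : Finset E) : Matrix E E ℝ :=
  Matrix.of fun i => if i ∈ F then G i else (1 : Matrix E E ℝ) i

theorem det_one_add_diagonal_mul {E : Type*} [Fintype E] [DecidableEq E]
    (w : E → ℝ) (G : Matrix E E ℝ) :
    (1 + Matrix.diagonal w * G).det = ∑ F : Finset E, (∏ e ∈ F, w e) * (rowMix G F).det := by
  have h := (Matrix.detRowAlternating (n := E) (R := ℝ)).map_add_univ
    (fun i => w i • G i) (fun i => (1 : Matrix E E ℝ) i)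
  have h1 : (1 + Matrix.diagonal w * G) =
      Matrix.of ((fun i => w i • G i) + (fun i => (1 : Matrix E E ℝ) i)) := by
    ext i j
    simp [Matrix.diagonal_mul, add_comm]
  rw [h1]
  refine h.trans (Finset.sum_congr rfl fun F _ => ?_)
  have h2 := Matrix.det_mul_column (fun i => if i ∈ F then w i else 1) (rowMix G F)
  have h3 : (∏ e ∈ F, w e) = ∏ i, (if i ∈ F then w i else 1) := by simp
  rw [h3, ← h2]
  change Matrix.det _ = _
  congr 1
  ext i j
  by_cases hi : i ∈ F <;> simp [rowMix, hi]

/-- The Gram matrix of the family `b` for the inner product with weights `1 / υ`. -/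
noncomputable def weightedGram {E V : Type*} [Fintype V] (b : E → V → ℝ) (υ : V → ℝ) :
    Matrix E E ℝ :=
  Matrix.of fun e f => ∑ x, b e x * b f x / υ x

theorem det_rowMix_insert_eq_zero {E V : Type*} [Fintype E] [DecidableEq E] [Fintype V]
    (b : E → V → ℝ) (υ : V → ℝ) (hυ : ∀ v, 0 < υ v) (F : Finset E) (e : E)
    (h : (rowMix (weightedGram b υ) F).det = 0) :
    (rowMix (weightedGram b υ) (insert e F)).det = 0 := by
  obtain ⟨y, hy, hMy⟩ := Matrix.exists_mulVec_eq_zero_iff.mpr h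
  refine Matrix.exists_mulVec_eq_zero_iff.mp ⟨y, hy, ?_⟩
  have hG : ∀ f, (weightedGram b υ *ᵥ y) f = ∑ x, b f x * (∑ g, y g * b g x) / υ x := by
    intro f
    simp only [weightedGram, Matrix.mulVec, dotProduct, Matrix.of_apply, Finset.sum_mul,
      Finset.mul_sum, Finset.sum_div]
    rw [Finset.sum_comm]
    exact Finset.sum_congr rfl fun _ _ => Finset.sum_congr rfl fun _ _ => by ring
  have hin : ∀ f ∈ F, (weightedGram b υ *ᵥ y) f = 0 := by
    intro f hf
    have := congrFun hMy f
    simpa [rowMix, Matrix.mulVec, hf] using this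
  have hout : ∀ f ∉ F, y f = 0 := by
    intro f hf
    have := congrFun hMy f
    have h1 : ((1 : Matrix E E ℝ) *ᵥ y) f = 0 := by
      simpa only [rowMix, Matrix.mulVec, hf, Matrix.of_apply, if_false, Pi.zero_apply] using this
    simpa using h1
  have hsq : ∑ x, (∑ g, y g * b g x) ^ 2 / υ x = 0 := by
    have h0 : ∑ f, y f * (weightedGram b υ *ᵥ y) f = 0 :=
      Finset.sum_eq_zero fun f _ => by
        by_cases hf : f ∈ F
        · rw [hin f hf, mul_zero]
        · rw [hout f hf, zero_mul]
    rw [← h0]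
    simp only [hG, Finset.mul_sum]
    rw [Finset.sum_comm]
    refine Finset.sum_congr rfl fun x _ => ?_
    rw [sq, Finset.sum_mul, Finset.sum_div]
    exact Finset.sum_congr rfl fun f _ => by rw [← Finset.mul_sum]; ring
  have hz : ∀ x, ∑ g, y g * b g x = 0 := by
    intro x
    have := (Finset.sum_eq_zero_iff_of_nonneg
      (fun x _ => div_nonneg (sq_nonneg _) (hυ x).le)).mp hsq x (Finset.mem_univ x)
    rcases div_eq_zero_iff.mp this with h | h
    · exact pow_eq_zero_iff (two_ne_zero) |>.mp h
    · exact absurd h (hυ x).ne'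
  ext f
  by_cases hf : f ∈ insert e F
  · have : (weightedGram b υ *ᵥ y) f = 0 := by simp [hG, hz]
    simpa only [rowMix, Matrix.mulVec, hf, Matrix.of_apply, if_true, Pi.zero_apply] using this
  · have hf' : f ∉ F := fun h => hf (Finset.mem_insert_of_mem h)
    have : ((1 : Matrix E E ℝ) *ᵥ y) f = 0 := by simpa using hout f hf'
    simpa only [rowMix, Matrix.mulVec, hf, Matrix.of_apply, if_false, Pi.zero_apply] using this

theorem exists_det_rowMix_insert {E V : Type*} [Fintype E] [DecidableEq E] [Fintype V]
    (b : E → V → ℝ) (υ : V → ℝ) (hυ : ∀ v, 0 < υ v) (F : Finset E) (e : E) (he : e ∉ F)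
    (h : (rowMix (weightedGram b υ) F).det ≠ 0) :
    ∃ (p : V → ℝ) (y : E → ℝ), (∀ f ∈ F, ∑ x, b f x * p x = 0) ∧
      (∀ x, υ x * p x = b e x - ∑ f ∈ F, y f * b f x) ∧
      (rowMix (weightedGram b υ) (insert e F)).det =
        (∑ x, b e x * p x) * (rowMix (weightedGram b υ) F).det := by
  set G := weightedGram b υ with hGdef
  set M := rowMix G F with hM
  let y : E → ℝ := G e ᵥ* M⁻¹
  have hy : y ᵥ* M = G e := by
    simp only [y, Matrix.vecMul_vecMul]
    rw [Matrix.nonsing_inv_mul _ (isUnit_iff_ne_zero.mpr h), Matrix.vecMul_one]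
  have hyg : ∀ g, (∑ f ∈ F, y f * G f g) + (if g ∈ F then 0 else y g) = G e g := by
    intro g
    rw [← hy]
    simp only [Matrix.vecMul, dotProduct]
    rw [← Finset.sum_add_sum_compl F]
    congr 1
    · exact Finset.sum_congr rfl fun f hf => by simp [hM, rowMix, hf]
    · have : ∀ f ∈ Fᶜ, y f * M f g = if f = g then y f else 0 := by
        intro f hf
        have hf' : f ∉ F := by simpa using hf
        simp [hM, rowMix, hf', Matrix.one_apply]
      rw [Finset.sum_congr rfl this, Finset.sum_ite_eq']
      by_cases hg : g ∈ F <;> simp [hg]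
  have hp : ∀ g, ∑ x, b g x * ((b e x - ∑ f ∈ F, y f * b f x) / υ x) =
      G e g - ∑ f ∈ F, y f * G f g := by
    intro g
    simp only [hGdef, weightedGram, Matrix.of_apply, Finset.mul_sum]
    rw [Finset.sum_comm, ← Finset.sum_sub_distrib]
    refine Finset.sum_congr rfl fun x _ => ?_
    rw [sub_div, mul_sub, Finset.sum_div, Finset.mul_sum]
    congr 1
    · ring
    · exact Finset.sum_congr rfl fun f _ => by ring
  refine ⟨fun x => (b e x - ∑ f ∈ F, y f * b f x) / υ x, y, ?_, ?_, ?_⟩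
  · intro g hg
    rw [hp, ← hyg g]
    simp [hg]
  · intro x
    field_simp [(hυ x).ne']
  · have hup : rowMix G (insert e F) = M.updateRow e (∑ k, y k • M k) := by
      have h1 : (∑ k, y k • M k) = G e := by
        rw [← hy]
        ext g
        simp [Matrix.vecMul, dotProduct, Finset.sum_apply]
      rw [h1]
      ext i j
      by_cases hi : i = e
      · subst hi
        simp [rowMix]
      · simp [hM, rowMix, hi, Matrix.updateRow_ne]
    rw [hup, Matrix.det_updateRow_sum, hp, ← hyg e]
    simp [he]

/-- The product, over the nonempty fibres of `q`, of the total weight of the fibre. -/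
noncomputable def fiberProd {V Q : Type*} [Fintype V] (υ : V → ℝ) (q : V → Q) : ℝ :=
  ∏ c ∈ Finset.univ.image q, ∑ x with q x = c, υ x

theorem fiberProd_and_card_of_ker_eq {V Q Q' : Type*} [Fintype V] (υ : V → ℝ)
    (q : V → Q) (q' : V → Q') (h : ∀ x y, q' x = q' y ↔ q x = q y) :
    fiberProd υ q' = fiberProd υ q ∧
      (Finset.univ.image q').card = (Finset.univ.image q).card := by
  rcases isEmpty_or_nonempty V with hV | ⟨⟨v⟩⟩
  · simp [fiberProd, Finset.univ_eq_empty]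
  let g : Q → Q' := Function.extend q q' fun _ => q' v
  have hg : ∀ x, g (q x) = q' x := fun x =>
    Function.FactorsThrough.extend_apply (fun x y hxy => (h x y).mpr hxy) _ x
  have himg : Finset.univ.image q' = (Finset.univ.image q).image g := by
    rw [Finset.image_image]
    exact Finset.image_congr fun x _ => (hg x).symm
  have hinj : Set.InjOn g (Finset.univ.image q : Finset Q) := by
    intro a ha b hb hab
    simp only [Finset.coe_image, Finset.coe_univ, Set.image_univ, Set.mem_range] at ha hb
    obtain ⟨x, rfl⟩ := ha
    obtain ⟨y, rfl⟩ := hb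
    rw [hg, hg] at hab
    exact (h x y).mp hab
  constructor
  · rw [fiberProd, fiberProd, himg, Finset.prod_image hinj]
    refine Finset.prod_congr rfl fun c hc => ?_
    simp only [Finset.mem_image, Finset.mem_univ, true_and] at hc
    obtain ⟨y, rfl⟩ := hc
    refine Finset.sum_congr ?_ fun _ _ => rfl
    ext x
    simp [hg, h]
  · rw [himg, Finset.card_image_of_injOn hinj]

theorem fiberProd_and_card_of_merge {V Q Q' : Type*} [Fintype V] (υ : V → ℝ)
    (q : V → Q) (q' : V → Q') (u v : V) (huv : q u ≠ q v)
    (h : ∀ x y, q' x = q' y ↔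
      (q x = q y ∨ (q x = q u ∧ q y = q v) ∨ (q x = q v ∧ q y = q u))) :
    fiberProd υ q' * ((∑ x with q x = q u, υ x) * ∑ x with q x = q v, υ x) =
        fiberProd υ q * ((∑ x with q x = q u, υ x) + ∑ x with q x = q v, υ x) ∧
      (Finset.univ.image q').card + 1 = (Finset.univ.image q).card := by
  let r : V → Q := fun x => if q x = q v then q u else q x
  obtain ⟨h1, h2⟩ := fiberProd_and_card_of_ker_eq υ r q' fun x y => by
    rw [h]
    simp only [r]
    split_ifs <;> grind
  have himg : Finset.univ.image r = (Finset.univ.image q).erase (q v) := by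
    ext c
    simp only [Finset.mem_image, Finset.mem_univ, true_and, Finset.mem_erase, r]
    constructor
    · rintro ⟨x, rfl⟩
      split_ifs with hx
      · exact ⟨huv, u, rfl⟩
      · exact ⟨hx, x, rfl⟩
    · rintro ⟨hc, x, rfl⟩
      exact ⟨x, if_neg hc⟩
  have hv : q v ∈ Finset.univ.image q := Finset.mem_image_of_mem q (Finset.mem_univ v)
  have hu : q u ∈ (Finset.univ.image q).erase (q v) :=
    Finset.mem_erase.mpr ⟨huv, Finset.mem_image_of_mem q (Finset.mem_univ u)⟩
  constructor
  · have hru : ∑ x with r x = q u, υ x =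
        (∑ x with q x = q u, υ x) + ∑ x with q x = q v, υ x := by
      rw [← Finset.sum_union]
      · refine Finset.sum_congr ?_ fun _ _ => rfl
        ext x
        simp only [Finset.mem_filter, Finset.mem_univ, true_and, Finset.mem_union, r]
        split_ifs <;> grind
      · rw [Finset.disjoint_filter]
        intro x _ hx hx'
        exact huv (hx.symm.trans hx')
    have hrest : ∏ c ∈ ((Finset.univ.image q).erase (q v)).erase (q u), ∑ x with r x = c, υ x =
        ∏ c ∈ ((Finset.univ.image q).erase (q v)).erase (q u), ∑ x with q x = c, υ x := by
      refine Finset.prod_congr rfl fun c hc => Finset.sum_congr ?_ fun _ _ => rfl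
      simp only [Finset.mem_erase] at hc
      ext x
      simp only [Finset.mem_filter, Finset.mem_univ, true_and, r]
      split_ifs <;> grind
    rw [h1, fiberProd, fiberProd, himg, ← Finset.mul_prod_erase _ _ hu, hru, hrest,
      ← Finset.mul_prod_erase _ _ hv, ← Finset.mul_prod_erase _ _ hu]
    ring
  · rw [h2, himg, Finset.card_erase_add_one hv]

theorem SimpleGraph.reachable_sup_edge_iff {V : Type*} (G : SimpleGraph V) (u v x y : V) :
    (G ⊔ SimpleGraph.edge u v).Reachable x y ↔
      (G.Reachable x y ∨ (G.Reachable x u ∧ G.Reachable y v) ∨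
        (G.Reachable x v ∧ G.Reachable y u)) := by
  constructor
  · rintro ⟨w⟩
    induction w with
    | nil => exact Or.inl (SimpleGraph.Reachable.refl _)
    | @cons a b c hab _ ih =>
      rw [SimpleGraph.sup_adj, SimpleGraph.edge_adj] at hab
      have tr : ∀ {a b c : V}, G.Reachable a b → G.Reachable b c → G.Reachable a c :=
        fun h h' => h.trans h'
      have sy : ∀ {a b : V}, G.Reachable a b → G.Reachable b a := fun h => h.symm
      have rf : ∀ a, G.Reachable a a := fun a => SimpleGraph.Reachable.refl a
      rcases hab with hab | ⟨⟨rfl, rfl⟩ | ⟨rfl, rfl⟩, _⟩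
      · have := hab.reachable
        grind
      · grind
      · grind
  · have hle : ∀ {a b}, G.Reachable a b → (G ⊔ SimpleGraph.edge u v).Reachable a b :=
      fun h => h.mono le_sup_left
    have huv : (G ⊔ SimpleGraph.edge u v).Reachable u v := by
      by_cases h : u = v
      · rw [h]
      · exact (SimpleGraph.sup_adj _ _ _ _ |>.mpr
          (Or.inr ((SimpleGraph.edge_adj _ _ _ _).mpr ⟨Or.inl ⟨rfl, rfl⟩, h⟩))).reachable
    rintro (h | ⟨h, h'⟩ | ⟨h, h'⟩)
    · exact hle h
    · exact (hle h).trans (huv.trans (hle h').symm)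
    · exact (hle h).trans (huv.symm.trans (hle h').symm)

/-- The signed incidence vector of an edge, for an arbitrary choice of orientation. -/
noncomputable def incVec {V : Type*} (e : Sym2 V) (x : V) : ℝ :=
  (if x = e.out.1 then 1 else 0) - (if x = e.out.2 then 1 else 0)

theorem Sym2.mk_out {V : Type*} (e : Sym2 V) : s(e.out.1, e.out.2) = e :=
  Quot.out_eq e

theorem sum_incVec_mul {V : Type*} [Fintype V] (e : Sym2 V) (p : V → ℝ) :
    ∑ x, incVec e x * p x = p e.out.1 - p e.out.2 := by
  simp [incVec, sub_mul]

theorem sum_filter_incVec {V : Type*} [Fintype V] (e : Sym2 V) (P : V → Prop) :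
    ∑ x with P x, incVec e x =
      (if P e.out.1 then 1 else 0) - (if P e.out.2 then 1 else 0) := by
  have := sum_incVec_mul e fun x => if P x then 1 else 0
  rw [← this, Finset.sum_filter]
  exact Finset.sum_congr rfl fun x _ => by split_ifs <;> simp

theorem lapMat_eq_sum_incVec {V : Type} [Fintype V] [DecidableEq V] (ε : V → V → ℝ)
    (hsym : ∀ u v, ε u v = ε v u) (x y : V) :
    lapMat ε x y =
      ∑ e, incVec e x * (Sym2.lift ⟨ε, fun a b => hsym a b⟩ e * incVec e y) := by
  let N : V → V → ℝ := fun x y =>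
    ∑ e, incVec e x * (Sym2.lift ⟨ε, fun a b => hsym a b⟩ e * incVec e y)
  have hNe : ∀ x y, N x y =
      ∑ e, incVec e x * (Sym2.lift ⟨ε, fun a b => hsym a b⟩ e * incVec e y) := fun _ _ => rfl
  rw [← hNe]
  have hoff : ∀ x y, x ≠ y → N x y = lapMat ε x y := by
    intro x y hxy
    rw [hNe, Finset.sum_eq_single s(x, y)]
    · have h := Sym2.mk_out s(x, y)
      rw [Sym2.eq_iff] at h
      rcases h with ⟨h1, h2⟩ | ⟨h1, h2⟩ <;>
        simp [incVec, h1, h2, hxy, hxy.symm, lapMat]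
    · intro e _ he
      by_cases hd : e.out.1 = e.out.2
      · have h0 : incVec e x = 0 := by
          simp only [incVec]
          split_ifs <;> grind
        rw [h0, zero_mul]
      have h := Sym2.mk_out e
      have h1 : ¬ (x = e.out.1 ∧ y = e.out.2) := by
        rintro ⟨h1, h2⟩
        exact he (by rw [h1, h2, h])
      have h2 : ¬ (x = e.out.2 ∧ y = e.out.1) := by
        rintro ⟨h1, h2⟩
        exact he (by rw [h1, h2, Sym2.eq_swap, h])
      simp only [incVec]
      split_ifs <;> grind
    · simp
  have hrowN : ∀ x, ∑ y, N x y = 0 := by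
    intro x
    simp only [hNe]
    rw [Finset.sum_comm]
    refine Finset.sum_eq_zero fun e _ => ?_
    have := sum_incVec_mul e fun _ => 1
    simp only [mul_one, sub_self] at this
    rw [← Finset.mul_sum, ← Finset.mul_sum, this, mul_zero, mul_zero]
  have hrowL : ∀ x, ∑ y, lapMat ε x y = 0 := by
    intro x
    simp [lapMat, Finset.sum_sub_distrib, Matrix.diagonal_apply]
  by_cases hxy : x = y
  · subst hxy
    have h1 := hrowN x
    have h2 := hrowL x
    rw [← Finset.add_sum_erase _ _ (Finset.mem_univ x)] at h1 h2
    have h3 : ∑ y ∈ Finset.univ.erase x, N x y = ∑ y ∈ Finset.univ.erase x, lapMat ε x y :=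
      Finset.sum_congr rfl fun y hy => hoff x y (Finset.ne_of_mem_erase hy).symm
    linarith
  · exact (hoff x y hxy).symm

/-- A set of pairs of vertices is a forest if it contains no loop and no cycle. -/
def IsForest {V : Type*} (F : Finset (Sym2 V)) : Prop :=
  (∀ e ∈ F, ¬ e.IsDiag) ∧ (SimpleGraph.fromEdgeSet (↑F : Set (Sym2 V))).IsAcyclic

theorem fromEdgeSet_insert {V : Type*} (F : Finset (Sym2 V)) (e : Sym2 V) :
    SimpleGraph.fromEdgeSet (↑(insert e F) : Set (Sym2 V)) =
      SimpleGraph.fromEdgeSet (↑F : Set (Sym2 V)) ⊔ SimpleGraph.edge e.out.1 e.out.2 := by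
  rw [SimpleGraph.edge, Sym2.mk_out, Finset.coe_insert, Set.insert_eq, Set.union_comm]
  exact SimpleGraph.fromEdgeSet_union _ _

theorem isForest_insert_iff {V : Type*} (F : Finset (Sym2 V)) (e : Sym2 V) (he : e ∉ F) :
    IsForest (insert e F) ↔ IsForest F ∧
      ¬ (SimpleGraph.fromEdgeSet (↑F : Set (Sym2 V))).Reachable e.out.1 e.out.2 := by
  rw [IsForest, IsForest, fromEdgeSet_insert, SimpleGraph.isAcyclic_sup_fromEdgeSet_iff]
  have hd : e.IsDiag ↔ e.out.1 = e.out.2 := by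
    conv_lhs => rw [← Sym2.mk_out e]
    exact Sym2.mk_isDiag_iff
  have hadj : ¬ (SimpleGraph.fromEdgeSet (↑F : Set (Sym2 V))).Adj e.out.1 e.out.2 := by
    rw [SimpleGraph.fromEdgeSet_adj, Sym2.mk_out]
    exact fun h => he h.1
  have hr : e.out.1 = e.out.2 →
      (SimpleGraph.fromEdgeSet (↑F : Set (Sym2 V))).Reachable e.out.1 e.out.2 := by
    intro h
    rw [h]
  rw [Finset.forall_mem_insert]
  tauto

theorem fiberProd_pos {V Q : Type*} [Fintype V] (υ : V → ℝ) (hυ : ∀ v, 0 < υ v) (q : V → Q) :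
    0 < fiberProd υ q := by
  refine Finset.prod_pos fun c hc => Finset.sum_pos (fun x _ => hυ x) ?_
  obtain ⟨x, _, rfl⟩ := Finset.mem_image.mp hc
  exact ⟨x, by simp⟩

theorem det_rowMix_weightedGram_incVec {V : Type*} [Fintype V] (υ : V → ℝ)
    (hυ : ∀ v, 0 < υ v) (F : Finset (Sym2 V)) :
    (IsForest F →
      (∏ v, υ v) * (rowMix (weightedGram incVec υ) F).det =
          fiberProd υ (SimpleGraph.fromEdgeSet (↑F : Set (Sym2 V))).connectedComponentMk ∧
        (Finset.univ.image
          (SimpleGraph.fromEdgeSet (↑F : Set (Sym2 V))).connectedComponentMk).card + F.card =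
            Fintype.card V) ∧
    (¬ IsForest F → (rowMix (weightedGram incVec υ) F).det = 0) := by
  induction F using Finset.induction_on with
  | empty =>
    have h1 : (rowMix (weightedGram incVec υ) (∅ : Finset (Sym2 V))) = 1 := by
      ext i j
      simp [rowMix]
    have hker : ∀ x y : V, (SimpleGraph.fromEdgeSet
        (↑(∅ : Finset (Sym2 V)) : Set (Sym2 V))).connectedComponentMk x =
        (SimpleGraph.fromEdgeSet
          (↑(∅ : Finset (Sym2 V)) : Set (Sym2 V))).connectedComponentMk y ↔ id x = id y := by
      intro x y
      simp
    obtain ⟨h2, h3⟩ := fiberProd_and_card_of_ker_eq υ id _ hker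
    refine ⟨fun _ => ⟨?_, ?_⟩, fun h => absurd ?_ h⟩
    · rw [h2, h1]
      simp [fiberProd, Finset.sum_filter]
    · rw [h3]
      simp
    · exact ⟨by simp, by simp⟩
  | insert e F he ih =>
    have hins := isForest_insert_iff F e he
    by_cases hF : IsForest F
    swap
    · exact ⟨fun h => absurd (hins.mp h).1 hF,
        fun _ => det_rowMix_insert_eq_zero _ υ hυ F e (ih.2 hF)⟩
    obtain ⟨hdet, hcard⟩ := ih.1 hF
    have hpos := fiberProd_pos υ hυ
      (SimpleGraph.fromEdgeSet (↑F : Set (Sym2 V))).connectedComponentMk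
    have hne : (rowMix (weightedGram incVec υ) F).det ≠ 0 := by
      intro h
      rw [h, mul_zero] at hdet
      exact hpos.ne hdet
    obtain ⟨p, y, hp, hres, hdet'⟩ :=
      exists_det_rowMix_insert incVec υ hυ F e he hne
    rw [sum_incVec_mul] at hdet'
    set H := SimpleGraph.fromEdgeSet (↑F : Set (Sym2 V)) with hH
    have hpF : ∀ f ∈ F, p f.out.1 = p f.out.2 := by
      intro f hf
      have := hp f hf
      rw [sum_incVec_mul] at this
      linarith
    have hpadj : ∀ a b, H.Adj a b → p a = p b := by
      intro a b hab
      rw [hH, SimpleGraph.fromEdgeSet_adj] at hab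
      have h1 := hpF _ hab.1
      have h2 := Sym2.mk_out s(a, b)
      rw [Sym2.eq_iff] at h2
      rcases h2 with ⟨h2, h3⟩ | ⟨h2, h3⟩
      · rwa [h2, h3] at h1
      · rw [h2, h3] at h1
        exact h1.symm
    have hpreach : ∀ a b, H.Reachable a b → p a = p b := by
      rintro a b ⟨w⟩
      induction w with
      | nil => rfl
      | cons hab _ ih' => exact (hpadj _ _ hab).trans ih'
    by_cases hr : H.Reachable e.out.1 e.out.2
    · refine ⟨fun h => absurd hr (hins.mp h).2, fun _ => ?_⟩
      rw [hdet', hpreach _ _ hr, sub_self, zero_mul]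
    refine ⟨fun _ => ?_, fun h => absurd (hins.mpr ⟨hF, hr⟩) h⟩
    have hfib : ∀ z, (∑ x with H.connectedComponentMk x = H.connectedComponentMk z, υ x) * p z =
        (if H.connectedComponentMk e.out.1 = H.connectedComponentMk z then 1 else 0) -
          (if H.connectedComponentMk e.out.2 = H.connectedComponentMk z then 1 else 0) := by
      intro z
      rw [← sum_filter_incVec e fun x => H.connectedComponentMk x = H.connectedComponentMk z,
        Finset.sum_mul]
      have h1 : ∀ x ∈ Finset.univ.filter
          (fun x => H.connectedComponentMk x = H.connectedComponentMk z),
          υ x * p z = incVec e x - ∑ f ∈ F, y f * incVec f x := by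
        intro x hx
        rw [← hres x, hpreach x z (SimpleGraph.ConnectedComponent.exact (by simpa using hx))]
      rw [Finset.sum_congr rfl h1, Finset.sum_sub_distrib, Finset.sum_comm, sub_eq_self]
      refine Finset.sum_eq_zero fun f hf => ?_
      rw [← Finset.mul_sum, sum_filter_incVec]
      have h2 : H.connectedComponentMk f.out.1 = H.connectedComponentMk f.out.2 := by
        refine SimpleGraph.ConnectedComponent.sound (SimpleGraph.Adj.reachable ?_)
        rw [hH, SimpleGraph.fromEdgeSet_adj, Sym2.mk_out]
        refine ⟨hf, fun h => hF.1 f hf ?_⟩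
        rw [← Sym2.mk_out f]
        exact Sym2.mk_isDiag_iff.mpr h
      rw [h2, sub_self, mul_zero]
    have hne' : H.connectedComponentMk e.out.1 ≠ H.connectedComponentMk e.out.2 :=
      fun h => hr (SimpleGraph.ConnectedComponent.exact h)
    have hu := hfib e.out.1
    have hv := hfib e.out.2
    rw [if_pos rfl, if_neg hne'.symm, sub_zero] at hu
    rw [if_pos rfl, if_neg hne', zero_sub] at hv
    obtain ⟨hprod, hcard'⟩ := fiberProd_and_card_of_merge υ H.connectedComponentMk
      (SimpleGraph.fromEdgeSet (↑(insert e F) : Set (Sym2 V))).connectedComponentMk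
      e.out.1 e.out.2 hne' fun a b => by
        simp only [SimpleGraph.ConnectedComponent.eq]
        rw [fromEdgeSet_insert]
        exact SimpleGraph.reachable_sup_edge_iff H _ _ a b
    constructor
    · rw [hdet']
      set A := ∑ x with H.connectedComponentMk x = H.connectedComponentMk e.out.1, υ x
      set B := ∑ x with H.connectedComponentMk x = H.connectedComponentMk e.out.2, υ x
      have hA : A ≠ 0 := fun h => by simp [h] at hu
      have hB : B ≠ 0 := fun h => by simp [h] at hv
      refine mul_right_cancel₀ (mul_ne_zero hA hB) ?_
      rw [hprod, ← hdet]
      linear_combination (∏ v, υ v) * (rowMix (weightedGram incVec υ) F).det * (B * hu - A * hv)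
    · rw [Finset.card_insert_of_notMem he]
      omega

theorem eval_Ppoly {V : Type} [Fintype V] [DecidableEq V] (ε : V → V → ℝ)
    (hsym : ∀ u v, ε u v = ε v u)
    (υ : V → ℝ) (hυ : ∀ v, 0 < υ v) (t : ℝ) (ht : t ≠ 0) :
    (Ppoly ε υ).eval t = t ^ Fintype.card V * ∑ F : Finset (Sym2 V),
      (∏ e ∈ F, (-Sym2.lift ⟨ε, fun a b => hsym a b⟩ e / t)) *
        ((∏ v, υ v) * (rowMix (weightedGram incVec υ) F).det) := by
  set w := Sym2.lift ⟨ε, fun a b => hsym a b⟩ with hw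
  let B : Matrix V (Sym2 V) ℝ := Matrix.of fun x e => incVec e x
  have h1 : (Ppoly ε υ).eval t = (Matrix.diagonal (fun v => t * υ v) *
      (1 + (Matrix.diagonal (fun v => (υ v)⁻¹) * B) *
        (Matrix.diagonal (fun e => -w e / t) * Bᵀ))).det := by
    rw [Ppoly, ← Polynomial.coe_evalRingHom, RingHom.map_det]
    congr 1
    ext x y
    have hxy : lapMat ε x y = ∑ e, incVec e x * (w e * incVec e y) :=
      lapMat_eq_sum_incVec ε hsym x y
    have hne := (hυ x).ne'
    rw [Matrix.diagonal_mul, Matrix.add_apply, Matrix.mul_apply]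
    simp only [RingHom.mapMatrix_apply, Matrix.map_apply, Matrix.of_apply,
      Polynomial.coe_evalRingHom, Polynomial.eval_sub, Polynomial.eval_mul, Polynomial.eval_X,
      Polynomial.eval_C, Matrix.diagonal_mul, Matrix.transpose_apply, B, mul_add]
    rw [hxy, sub_eq_add_neg, ← Finset.sum_neg_distrib, Finset.mul_sum]
    congr 1
    · by_cases h : x = y <;> simp [h, Matrix.one_apply]
    · refine Finset.sum_congr rfl fun e _ => ?_
      field_simp
  have hG : (Matrix.diagonal (fun e => -w e / t) * Bᵀ) *
      (Matrix.diagonal (fun v => (υ v)⁻¹) * B) =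
      Matrix.diagonal (fun e => -w e / t) * weightedGram incVec υ := by
    rw [Matrix.mul_assoc]
    congr 1
    ext e f
    rw [Matrix.mul_apply]
    simp only [Matrix.diagonal_mul, weightedGram, Matrix.of_apply, B,
      Matrix.transpose_apply]
    exact Finset.sum_congr rfl fun x _ => by ring
  rw [h1, Matrix.det_mul, Matrix.det_one_add_mul_comm, hG, det_one_add_diagonal_mul,
    Matrix.det_diagonal, Finset.prod_mul_distrib, Finset.prod_const, Finset.card_univ,
    mul_assoc, Finset.mul_sum]
  congr 1
  exact Finset.sum_congr rfl fun F _ => by ring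

/-- **Weighted matrix-forest theorem.** The coefficient of `t^k` in
`det (t • W(υ) - L(ε))` is `(-1)^(n-k)` times the sum of the weights of all
spanning forests of `G(ε)` with exactly `k` connected components. -/
theorem weighted_matrix_forest
    {V : Type} [Fintype V] [DecidableEq V]
    (ε : V → V → ℝ) (hsym : ∀ u v, ε u v = ε v u)
    (hnonneg : ∀ u v, 0 ≤ ε u v) (hdiag : ∀ v, ε v v = 0)
    (υ : V → ℝ) (hυ : ∀ v, 0 < υ v)
    (n : ℕ) (hn : n = Fintype.card V)
    (εe : Sym2 V → ℝ) (hεe : εe = Sym2.lift ⟨ε, fun a b => hsym a b⟩)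
    (k : ℕ) (hk : k ≤ n) :
    (Ppoly ε υ).coeff k =
      (-1 : ℝ) ^ (n - k) *
        ∑ F ∈ Finset.univ.filter (fun F : Finset (Sym2 V) =>
            (∀ e ∈ F, ¬ e.IsDiag ∧ 0 < εe e) ∧
            (SimpleGraph.fromEdgeSet (↑F : Set (Sym2 V))).IsAcyclic ∧
            (Finset.univ.image
              (SimpleGraph.fromEdgeSet (↑F : Set (Sym2 V))).connectedComponentMk).card = k),
          ((∏ e ∈ F, εe e) *
            ∏ c ∈ Finset.univ.image
                (SimpleGraph.fromEdgeSet (↑F : Set (Sym2 V))).connectedComponentMk,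
              ∑ v ∈ Finset.univ.filter
                  (fun v =>
                    (SimpleGraph.fromEdgeSet (↑F : Set (Sym2 V))).connectedComponentMk v = c),
                υ v) := by
  subst hεe hn
  set w := Sym2.lift ⟨ε, fun a b => hsym a b⟩ with hw
  let c : Finset (Sym2 V) → ℝ := fun F =>
    (∏ v, υ v) * (rowMix (weightedGram incVec υ) F).det
  have hc1 : ∀ F, IsForest F → c F =
      fiberProd υ (SimpleGraph.fromEdgeSet (↑F : Set (Sym2 V))).connectedComponentMk :=
    fun F hF => by convert ((det_rowMix_weightedGram_incVec υ hυ F).1 hF).1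
  have hc2 : ∀ F : Finset (Sym2 V), IsForest F → (Finset.univ.image
      (SimpleGraph.fromEdgeSet (↑F : Set (Sym2 V))).connectedComponentMk).card + F.card =
        Fintype.card V :=
    fun F hF => by convert ((det_rowMix_weightedGram_incVec υ hυ F).1 hF).2
  have hc3 : ∀ F, ¬ IsForest F → c F = 0 := fun F hF => by
    have h := (det_rowMix_weightedGram_incVec υ hυ F).2 hF
    rw [← mul_zero (∏ v, υ v), ← h]
    congr!
  have hP : Ppoly ε υ = ∑ F : Finset (Sym2 V),
      Polynomial.C ((-1) ^ F.card * (∏ e ∈ F, w e) * c F) *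
        Polynomial.X ^ (Fintype.card V - F.card) := by
    refine Polynomial.eq_of_infinite_eval_eq _ _
      ((Set.finite_singleton (0 : ℝ)).infinite_compl.mono fun t ht => ?_)
    have ht : t ≠ 0 := by simpa using ht
    rw [Set.mem_ofPred_eq, eval_Ppoly ε hsym υ hυ t ht, Polynomial.eval_finsetSum,
      Finset.mul_sum]
    refine Finset.sum_congr rfl fun F _ => ?_
    rw [Polynomial.eval_mul, Polynomial.eval_C, Polynomial.eval_pow, Polynomial.eval_X]
    change _ * (_ * c F) = _
    by_cases hF : IsForest F
    · have hle : F.card ≤ Fintype.card V := by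
        have := hc2 F hF
        omega
      rw [Finset.prod_div_distrib, Finset.prod_neg, Finset.prod_const, pow_sub₀ t ht hle]
      ring
    · rw [hc3 F hF]
      ring
  rw [hP, Polynomial.finsetSum_coeff, Finset.mul_sum, Finset.sum_filter]
  refine Finset.sum_congr rfl fun F _ => ?_
  rw [Polynomial.coeff_C_mul_X_pow]
  by_cases hF : IsForest F
  swap
  · rw [hc3 F hF, mul_zero, ite_self, if_neg fun h => hF ⟨fun e he => (h.1 e he).1, h.2.1⟩]
  have hcard := hc2 F hF
  by_cases hpos : ∀ e ∈ F, 0 < w e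
  · by_cases hk' : (Finset.univ.image
        (SimpleGraph.fromEdgeSet (↑F : Set (Sym2 V))).connectedComponentMk).card = k
    · rw [if_pos (by omega), if_pos ⟨fun e he => ⟨hF.1 e he, hpos e he⟩, hF.2, hk'⟩, hc1 F hF,
        show F.card = Fintype.card V - k by omega, mul_assoc]
      rfl
    · rw [if_neg (by omega), if_neg fun h => hk' h.2.2]
  · obtain ⟨e, he, hwe⟩ : ∃ e ∈ F, ¬ 0 < w e := by
      simpa only [not_forall, exists_prop] using hpos
    have hw0 : w e = 0 := by
      refine le_antisymm (not_lt.mp hwe) ?_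
      induction e using Sym2.ind with
      | h a b => exact hnonneg a b
    rw [Finset.prod_eq_zero he hw0]
    simp
end

section
/- Let ε be an edge-weight function and υ a vertex-weight function on a finite set V, and let a ≠ b be vertices with ε(a,b) > 0. Define the deletion ε_del to agree with ε except that ε_del(a,b) = ε_del(b,a) = 0. Define the contraction on V' = V ∖ {b} by: υ_con(a) = υ(a) + υ(b) and υ_con(x) = υ(x) for x ∈ V' with x ≠ a; and ε_con(x,y) = ε(x,y) for distinct x,y ∈ V' with x,y ≠ a, ε_con(x,a) = ε_con(a,x) = ε(x,a) + ε(x,b) for x ∈ V' with x ≠ a, and ε_con(x,x) = 0 for all x ∈ V'. Then, as polynomials in t, det(t·W(υ) − L(ε)) = det(t·W(υ) − L(ε_del)) − ε(a,b) · det(t·W(υ_con) − L(ε_con)). -/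
open Matrix Polynomial
open scoped Classical

/-- The weighted characteristic matrix `t • W(υ) - L(ε)`. -/
noncomputable def charLapMat {V : Type} [Fintype V] [DecidableEq V]
    (ε : V → V → ℝ) (υ : V → ℝ) : Matrix V V (Polynomial ℝ) :=
  Matrix.of fun u v =>
    Polynomial.X * Polynomial.C (Matrix.diagonal υ u v) - Polynomial.C (lapMat ε u v)

/-- Changing the diagonal entry at `b` changes the determinant by a multiple of the principal
minor obtained by deleting `b`. -/
theorem det_add_single_diag {V R : Type*} [Fintype V] [DecidableEq V] [CommRing R]
    (A : Matrix V V R) (b : V) (s : R) :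
    (A + Matrix.single b b s).det
      = A.det + s * (A.submatrix (Subtype.val : {x // x ≠ b} → V) Subtype.val).det := by
  have hrow : A + Matrix.single b b s = A.updateRow b (A b + Pi.single b s) := by
    ext i j
    by_cases hi : i = b
    · subst hi
      by_cases hj : j = i
      · subst hj; simp
      · simp [hj, Ne.symm hj]
    · simp [hi, Ne.symm hi]
  rw [hrow, Matrix.det_updateRow_add, Matrix.updateRow_eq_self]
  congr 1
  rw [Matrix.twoBlockTriangular_det _ (fun x => x ≠ b), mul_comm]
  · congr 1
    · let : Unique {x : V // ¬ x ≠ b} := ⟨⟨⟨b, by simp⟩⟩, fun x => Subtype.ext (by simpa using x.2)⟩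
      rw [Matrix.det_unique]
      have hd : ((default : {x : V // ¬ x ≠ b}) : V) = b := by
        simpa using (default : {x : V // ¬ x ≠ b}).2
      simp [Matrix.toSquareBlockProp, hd]
    · congr 1
      ext i j
      simp [Matrix.toSquareBlockProp, i.2]
  · intro i hi j hj
    have hi : i = b := by simpa using hi
    subst hi
    simp [hj]

/-- The matrix obtained from `A` by adding row `b` to row `a`, then column `b` to column `a`. -/
def addRowCol {V R : Type*} [DecidableEq V] [CommRing R] (a b : V) (A : Matrix V V R) :
    Matrix V V R :=
  Matrix.of fun i j =>
    A i j + (if i = a then A b j else 0) + (if j = a then A i b else 0)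
      + (if i = a ∧ j = a then A b b else 0)

theorem det_addRowCol {V R : Type*} [Fintype V] [DecidableEq V] [CommRing R] {a b : V}
    (hab : a ≠ b) (A : Matrix V V R) : (addRowCol a b A).det = A.det := by
  have h : addRowCol a b A
      = Matrix.transvection a b 1 * A * Matrix.transvection b a 1 := by
    ext i j
    by_cases hi : i = a <;> by_cases hj : j = a <;>
      simp [addRowCol, hi, hj] <;> ring
  rw [h, Matrix.det_mul, Matrix.det_mul, Matrix.det_transvection_of_ne _ _ hab,
    Matrix.det_transvection_of_ne _ _ hab.symm, one_mul, mul_one]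

theorem sum_eq_sum_ne_add {V M : Type*} [Fintype V] [AddCommMonoid M] (b : V)
    [Fintype {x : V // x ≠ b}] (f : V → M) :
    ∑ u, f u = (∑ u : {x : V // x ≠ b}, f u) + f b := by
  rw [← Finset.sum_erase_add _ _ (Finset.mem_univ b)]
  congr 1
  exact Finset.sum_subtype _ (by simp) f

/-- **Deletion-contraction** for the weighted Laplacian characteristic polynomial:
`P_(G,υ,ε)(t) = P_(G-e,υ,ε)(t) - ε(e) · P_(G/e,υ/e,ε)(t)`. -/
theorem deletion_contraction
    {V : Type} [Fintype V] [DecidableEq V]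
    (ε : V → V → ℝ) (hsym : ∀ u v, ε u v = ε v u)
    (hnonneg : ∀ u v, 0 ≤ ε u v) (hdiag : ∀ v, ε v v = 0)
    (υ : V → ℝ) (hυ : ∀ v, 0 < υ v)
    (a b : V) (hab : a ≠ b) (hεab : 0 < ε a b)
    (εdel : V → V → ℝ)
    (hdel : εdel = fun u v => if (u = a ∧ v = b) ∨ (u = b ∧ v = a) then 0 else ε u v)
    (υcon : {x : V // x ≠ b} → ℝ)
    (hυcon : υcon = fun x => if x.1 = a then υ a + υ b else υ x.1)
    (εcon : {x : V // x ≠ b} → {x : V // x ≠ b} → ℝ)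
    (hεcon : εcon = fun x y =>
      if x = y then 0
      else if x.1 = a then ε y.1 a + ε y.1 b
      else if y.1 = a then ε x.1 a + ε x.1 b
      else ε x.1 y.1) :
    Ppoly ε υ = Ppoly εdel υ - Polynomial.C (ε a b) * Ppoly εcon υcon := by
  have hdel_apply (u v : V) :
      εdel u v = if (u = a ∧ v = b) ∨ (u = b ∧ v = a) then 0 else ε u v := by rw [hdel]
  have hdeg (v : V) : ∑ u, ε v u
      = ∑ u, εdel v u + (if v = a then ε a b else 0) + (if v = b then ε a b else 0) := by
    have h (u : V) : ε v u = εdel v u + (if u = b then (if v = a then ε a b else 0) else 0)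
        + (if u = a then (if v = b then ε a b else 0) else 0) := by
      rw [hdel_apply]
      grind
    rw [Finset.sum_congr rfl fun u _ => h u]
    simp [Finset.sum_add_distrib]
  have hdegcon (x : {x : V // x ≠ b}) : ∑ u, εcon x u
      = ∑ u, εdel x.1 u + (if x.1 = a then ∑ u, εdel b u else 0) := by
    have h (u : {x : V // x ≠ b}) : εcon x u = εdel x.1 u.1
        + (if u = ⟨a, hab⟩ then εdel x.1 b else 0) + (if x.1 = a then εdel b u.1 else 0) := by
      rw [hdel_apply, hdel_apply, hdel_apply, hεcon]
      have := u.2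
      have := x.2
      grind
    rw [Finset.sum_congr rfl fun u _ => h u, sum_eq_sum_ne_add b (εdel x.1),
      sum_eq_sum_ne_add b (εdel b)]
    have hbb : εdel b b = 0 := by rw [hdel_apply]; grind
    rw [hbb]
    by_cases hx : x.1 = a <;> simp [Finset.sum_add_distrib, hx]
  have hdiff : addRowCol a b (charLapMat ε υ)
      = addRowCol a b (charLapMat εdel υ) + Matrix.single b b (-Polynomial.C (ε a b)) := by
    ext1 i j
    simp only [addRowCol, charLapMat, lapMat, Matrix.of_apply, Matrix.add_apply,
      Matrix.sub_apply, Matrix.diagonal_apply, Matrix.single_apply, hdeg, hdel_apply]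
    have := hsym a b
    by_cases hia : i = a <;> by_cases hib : i = b <;> by_cases hja : j = a <;>
      by_cases hjb : j = b <;> grind
  have hminor : (addRowCol a b (charLapMat εdel υ)).submatrix
      (Subtype.val : {x // x ≠ b} → V) Subtype.val = charLapMat εcon υcon := by
    ext1 i j
    simp only [addRowCol, charLapMat, lapMat, Matrix.of_apply, Matrix.submatrix_apply,
      Matrix.sub_apply, Matrix.diagonal_apply, hdegcon]
    rw [hυcon, hεcon]
    simp only [hdel_apply, Subtype.ext_iff]
    have := i.2
    have := j.2
    grind
  change (charLapMat ε υ).det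
    = (charLapMat εdel υ).det - Polynomial.C (ε a b) * (charLapMat εcon υcon).det
  rw [← det_addRowCol hab, hdiff, det_add_single_diag, det_addRowCol hab, hminor]
  ring
end

section
/- Let n ≥ 1 and let λ_1, …, λ_n and μ_1, …, μ_n be real numbers satisfying μ_i ≤ λ_i for all 1 ≤ i ≤ n and λ_i ≤ μ_{i+1} for all 1 ≤ i ≤ n−1. Suppose the real polynomial f(t) = ∏_{i=1}^n (t − λ_i) − ∏_{i=1}^n (t − μ_i) is not the zero polynomial. Then f has degree exactly n−1, all of its roots are real, and there exist real numbers ν_1 ≤ … ≤ ν_{n−1} and a nonzero real constant c such that f(t) = c · ∏_{i=1}^{n−1} (t − ν_i) and λ_i ≤ ν_i ≤ μ_{i+1} for all 1 ≤ i ≤ n−1. -/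
open Polynomial Filter Topology

/-- If `lam` and `mu` interlace, `∏ (X - lamᵢ) - ∏ (X - muᵢ)` has a root in each gap
`[lamᵢ, muᵢ₊₁]`. -/
theorem exists_root_prod_sub_prod_mem_gap {m : ℕ} {lam mu : Fin (m + 1) → ℝ}
    (h1 : ∀ i, mu i ≤ lam i) (h2 : ∀ i : Fin m, lam i.castSucc ≤ mu i.succ) (i : Fin m) :
    ∃ x ∈ Set.Icc (lam i.castSucc) (mu i.succ),
      ∏ j, (x - lam j) - ∏ j, (x - mu j) = 0 := by
  have hlam : Monotone lam :=
    Fin.monotone_iff_le_succ.2 fun j => (h2 j).trans (h1 _)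
  have hmu : Monotone mu :=
    Fin.monotone_iff_le_succ.2 fun j => (h1 _).trans (h2 j)
  set F : ℝ → ℝ := fun x => ∏ j, (x - lam j) - ∏ j, (x - mu j) with hF
  have hcont : ContinuousOn F (Set.uIcc (lam i.castSucc) (mu i.succ)) := by
    simp only [hF]
    fun_prop
  have hl : F (lam i.castSucc) = -∏ j, (lam i.castSucc - mu j) := by
    simp only [hF]
    rw [Finset.prod_eq_zero (Finset.mem_univ i.castSucc) (sub_self _), zero_sub]
  have hm : F (mu i.succ) = ∏ j, (mu i.succ - lam j) := by
    simp only [hF]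
    rw [Finset.prod_eq_zero (f := fun j => mu i.succ - mu j) (Finset.mem_univ i.succ)
      (sub_self _), sub_zero]
  have hsign : F (lam i.castSucc) * F (mu i.succ) ≤ 0 := by
    rw [hl, hm, neg_mul, ← Finset.prod_mul_distrib, neg_nonpos]
    refine Finset.prod_nonneg fun j _ => ?_
    rcases le_or_gt j i.castSucc with hj | hj
    · exact mul_nonneg (sub_nonneg.2 ((h1 j).trans (hlam hj)))
        (sub_nonneg.2 ((hlam hj).trans (h2 i)))
    · have hj' : i.succ ≤ j := Fin.castSucc_lt_iff_succ_le.1 hj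
      exact mul_nonneg_of_nonpos_of_nonpos (sub_nonpos.2 ((h2 i).trans (hmu hj')))
        (sub_nonpos.2 ((hmu hj').trans (h1 j)))
  have hzero : (0 : ℝ) ∈ Set.uIcc (F (lam i.castSucc)) (F (mu i.succ)) := by
    rw [Set.mem_uIcc]
    rcases mul_nonpos_iff.1 hsign with h | h
    · exact Or.inr ⟨h.2, h.1⟩
    · exact Or.inl h
  obtain ⟨x, hx, hx0⟩ := intermediate_value_uIcc hcont hzero
  rw [Set.uIcc_of_le (h2 i)] at hx
  exact ⟨x, hx, hx0⟩

/-- The coefficient of degree `m` of a difference of two monic split polynomials of degree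
`m + 1` is the difference of the sums of their roots. -/
theorem coeff_prod_X_sub_C_sub_prod_X_sub_C {m : ℕ} (lam mu : Fin (m + 1) → ℝ) :
    (∏ i, (X - C (lam i)) - ∏ i, (X - C (mu i))).coeff m = ∑ i, mu i - ∑ i, lam i := by
  have key (v : Fin (m + 1) → ℝ) : (∏ i, (X - C (v i))).coeff m = -∑ i, v i := by
    simpa using prod_X_sub_C_coeff_card_pred Finset.univ v (by simp)
  rw [coeff_sub, key, key]
  ring

theorem degree_prod_X_sub_C_sub_prod_X_sub_C_lt {m : ℕ} (lam mu : Fin (m + 1) → ℝ) :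
    (∏ i, (X - C (lam i)) - ∏ i, (X - C (mu i))).degree < ((m + 1 : ℕ) : WithBot ℕ) := by
  have hdeg (v : Fin (m + 1) → ℝ) : (∏ i, (X - C (v i))).degree = ((m + 1 : ℕ) : WithBot ℕ) := by
    simp [degree_prod]
  have hmonic (v : Fin (m + 1) → ℝ) : (∏ i, (X - C (v i))).Monic :=
    monic_prod_of_monic _ _ fun i _ => monic_X_sub_C _
  rw [← hdeg lam]
  exact degree_sub_lt_left ((hdeg lam).trans (hdeg mu).symm) (hmonic lam).ne_zero
    ((hmonic lam).leadingCoeff.trans (hmonic mu).leadingCoeff.symm)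

/-- The factorization of `∏ (X - lamᵢ) - ∏ (X - muᵢ)` when `muᵢ < lamᵢ`, so that the roots found
in the gaps are distinct. -/
theorem exists_interlacing_factorization_of_lt {m : ℕ} {lam mu : Fin (m + 1) → ℝ}
    (h1 : ∀ i, mu i < lam i) (h2 : ∀ i : Fin m, lam i.castSucc ≤ mu i.succ) :
    ∃ nu : Fin m → ℝ, (∀ i, nu i ∈ Set.Icc (lam i.castSucc) (mu i.succ)) ∧
      ∏ i, (X - C (lam i)) - ∏ i, (X - C (mu i)) =
        C (∑ i, mu i - ∑ i, lam i) * ∏ i, (X - C (nu i)) := by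
  choose nu hnu hroot using exists_root_prod_sub_prod_mem_gap (fun i => (h1 i).le) h2
  refine ⟨nu, hnu, ?_⟩
  have hlam : Monotone lam := Fin.monotone_iff_le_succ.2 fun j => (h2 j).trans (h1 _).le
  have hmono : StrictMono nu := by
    intro i j hij
    calc nu i ≤ mu i.succ := (hnu i).2
      _ < lam i.succ := h1 _
      _ ≤ lam j.castSucc := hlam (by simpa [Fin.le_def] using hij)
      _ ≤ nu j := (hnu j).1
  have hdeg : (∏ i, (X - C (nu i))).degree = (m : WithBot ℕ) := by simp [degree_prod]
  have hmonic : (∏ i, (X - C (nu i))).Monic :=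
    monic_prod_of_monic _ _ fun i _ => monic_X_sub_C _
  have hcoeff : (∏ i, (X - C (nu i))).coeff m = 1 := by
    have := hmonic.coeff_natDegree
    rwa [natDegree_eq_of_degree_eq_some hdeg] at this
  rw [← sub_eq_zero]
  refine eq_zero_of_degree_lt_of_eval_index_eq_zero (s := Finset.univ) (v := nu)
    hmono.injective.injOn ?_ fun i _ => ?_
  · rw [Finset.card_univ, Fintype.card_fin, degree_lt_iff_coeff_zero]
    intro k hk
    rcases hk.eq_or_lt with rfl | hk
    · rw [coeff_sub, coeff_C_mul, hcoeff, coeff_prod_X_sub_C_sub_prod_X_sub_C, mul_one, sub_self]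
    · rw [coeff_sub, coeff_C_mul, coeff_eq_zero_of_degree_lt (hdeg.trans_lt (mod_cast hk)),
        (degree_lt_iff_coeff_zero _ _).1 (degree_prod_X_sub_C_sub_prod_X_sub_C_lt lam mu) k hk,
        mul_zero, sub_zero]
  · have h0 : ∏ j, (nu i - nu j) = 0 := Finset.prod_eq_zero (Finset.mem_univ i) (sub_self _)
    simp [eval_prod, h0, hroot i]

/-- The factorization of `∏ (X - lamᵢ) - ∏ (X - muᵢ)` for weakly interlacing `lam` and `mu`,
obtained as a limit of the case `muᵢ < lamᵢ`. -/
theorem exists_interlacing_factorization {m : ℕ} {lam mu : Fin (m + 1) → ℝ}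
    (h1 : ∀ i, mu i ≤ lam i) (h2 : ∀ i : Fin m, lam i.castSucc ≤ mu i.succ) :
    ∃ nu : Fin m → ℝ, (∀ i, nu i ∈ Set.Icc (lam i.castSucc) (mu i.succ)) ∧
      ∏ i, (X - C (lam i)) - ∏ i, (X - C (mu i)) =
        C (∑ i, mu i - ∑ i, lam i) * ∏ i, (X - C (nu i)) := by
  set e : ℕ → ℝ := fun k => 1 / ((k : ℝ) + 1) with he
  have hepos (k : ℕ) : 0 < e k := Nat.one_div_pos_of_nat
  have hele (k : ℕ) : e k ≤ 1 := by
    rw [he, div_le_one (by positivity)]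
    linarith [k.cast_nonneg (α := ℝ)]
  have helim : Tendsto e atTop (𝓝 0) := tendsto_one_div_add_atTop_nhds_zero_nat
  set L : ℕ → Fin (m + 1) → ℝ := fun k i => lam i + ((i : ℕ) + 1) * e k with hL
  set M : ℕ → Fin (m + 1) → ℝ := fun k i => mu i + (i : ℕ) * e k with hM
  have hLlim (i) : Tendsto (fun k => L k i) atTop (𝓝 (lam i)) := by
    simpa using (helim.const_mul (((i : ℕ) : ℝ) + 1)).const_add (lam i)
  have hMlim (i) : Tendsto (fun k => M k i) atTop (𝓝 (mu i)) := by
    simpa using (helim.const_mul ((i : ℕ) : ℝ)).const_add (mu i)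
  have hLM (k : ℕ) := exists_interlacing_factorization_of_lt (lam := L k) (mu := M k)
    (fun i => by simp only [hL, hM]; linarith [h1 i, hepos k])
    (fun i => by
      simp only [hL, hM, Fin.val_castSucc, Fin.val_succ]
      push_cast
      linarith [h2 i])
  choose nu hnu hfac using hLM
  have hcompact (k : ℕ) : nu k ∈ Set.Icc (fun i : Fin m => lam i.castSucc)
      (fun i : Fin m => mu i.succ + ((i.succ : ℕ) : ℝ)) := by
    refine ⟨fun i => le_trans ?_ (hnu k i).1, fun i => (hnu k i).2.trans ?_⟩
    · have := hepos k
      exact le_add_of_nonneg_right (by positivity)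
    · simp only [hM]
      gcongr
      exact mul_le_of_le_one_right (Nat.cast_nonneg _) (hele k)
  obtain ⟨v, -, φ, hφ, hv⟩ := isCompact_Icc.tendsto_subseq hcompact
  rw [tendsto_pi_nhds] at hv
  have hφ' := hφ.tendsto_atTop
  refine ⟨v, fun i => ⟨?_, ?_⟩, ?_⟩
  · exact le_of_tendsto_of_tendsto' ((hLlim _).comp hφ') (hv i) fun k => (hnu (φ k) i).1
  · exact le_of_tendsto_of_tendsto' (hv i) ((hMlim _).comp hφ') fun k => (hnu (φ k) i).2
  · refine Polynomial.funext fun t => ?_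
    have hl : Tendsto (fun k => ∏ i, (t - L (φ k) i) - ∏ i, (t - M (φ k) i)) atTop
        (𝓝 (∏ i, (t - lam i) - ∏ i, (t - mu i))) :=
      (tendsto_finsetProd _ fun i _ => ((hLlim i).comp hφ').const_sub t).sub
        (tendsto_finsetProd _ fun i _ => ((hMlim i).comp hφ').const_sub t)
    have hr : Tendsto (fun k => (∑ i, M (φ k) i - ∑ i, L (φ k) i) * ∏ i, (t - nu (φ k) i)) atTop
        (𝓝 ((∑ i, mu i - ∑ i, lam i) * ∏ i, (t - v i))) :=
      ((tendsto_finsetSum _ fun i _ => (hMlim i).comp hφ').sub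
        (tendsto_finsetSum _ fun i _ => (hLlim i).comp hφ')).mul
        (tendsto_finsetProd _ fun i _ => (hv i).const_sub t)
    have heq (k : ℕ) : ∏ i, (t - L (φ k) i) - ∏ i, (t - M (φ k) i) =
        (∑ i, M (φ k) i - ∑ i, L (φ k) i) * ∏ i, (t - nu (φ k) i) := by
      simpa only [eval_sub, eval_mul, eval_prod, eval_X, eval_C]
        using congrArg (eval t) (hfac (φ k))
    simp only [eval_sub, eval_mul, eval_prod, eval_X, eval_C]
    exact tendsto_nhds_unique hl (hr.congr fun k => (heq k).symm)

/-- **Interlacing roots of a difference of real-rooted polynomials.**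
If `μ₁ ≤ λ₁ ≤ μ₂ ≤ λ₂ ≤ … ≤ μₙ ≤ λₙ` and
`f = ∏ (X - λᵢ) - ∏ (X - μᵢ)` is nonzero, then `f` has degree `n - 1`,
all of its roots are real, and its roots `ν₁ ≤ … ≤ ν_{n-1}` satisfy
`λᵢ ≤ νᵢ ≤ μ_{i+1}`. -/
theorem interlacing_difference_of_polynomials
    (n : ℕ) (hn : 1 ≤ n) (lam mu : Fin n → ℝ)
    (h1 : ∀ i, mu i ≤ lam i)
    (h2 : ∀ i : Fin n, ∀ h : (i : ℕ) + 1 < n, lam i ≤ mu ⟨(i : ℕ) + 1, h⟩)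
    (f : Polynomial ℝ)
    (hf : f = ∏ i, (X - C (lam i)) - ∏ i, (X - C (mu i)))
    (hfne : f ≠ 0) :
    f.natDegree = n - 1 ∧
      ∃ (nu : Fin (n - 1) → ℝ) (c : ℝ), c ≠ 0 ∧ Monotone nu ∧
        f = C c * ∏ i, (X - C (nu i)) ∧
        ∀ i : Fin (n - 1),
          lam ⟨(i : ℕ), by have := i.2; omega⟩ ≤ nu i ∧
          nu i ≤ mu ⟨(i : ℕ) + 1, by have := i.2; omega⟩ := by
  obtain ⟨m, rfl⟩ : ∃ m, n = m + 1 := ⟨n - 1, by omega⟩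
  obtain ⟨nu, hnu, hfac⟩ := exists_interlacing_factorization h1
    fun i : Fin m => h2 i.castSucc (Nat.succ_lt_succ i.2)
  rw [← hf] at hfac
  have hc : ∑ i, mu i - ∑ i, lam i ≠ 0 := by
    intro h
    exact hfne (by rw [hfac, h, C_0, zero_mul])
  have hlam : Monotone lam :=
    Fin.monotone_iff_le_succ.2 fun j => (h2 j.castSucc (Nat.succ_lt_succ j.2)).trans (h1 _)
  refine ⟨?_, nu, _, hc, ?_, hfac, hnu⟩
  · rw [hfac, natDegree_C_mul hc, natDegree_finsetProd_X_sub_C_eq_card]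
    simp
  · intro i j hij
    rcases hij.eq_or_lt with rfl | hij
    · exact le_rfl
    · calc nu i ≤ mu i.succ := (hnu i).2
        _ ≤ lam i.succ := h1 _
        _ ≤ lam j.castSucc := hlam (by simpa [Fin.le_def] using hij)
        _ ≤ nu j := (hnu j).1
end

section
/- Let ε be an edge-weight function and υ a vertex-weight function on a finite set V with n = |V|, let a ≠ b be vertices with ε(a,b) > 0, and let ε_del agree with ε except that ε_del(a,b) = ε_del(b,a) = 0. Let λ_1 ≤ … ≤ λ_n and μ_1 ≤ … ≤ μ_n denote the weighted Laplacian eigenvalues of (ε,υ) and (ε_del,υ), respectively. Then μ_i ≤ λ_i for all 1 ≤ i ≤ n, and λ_i ≤ μ_{i+1} for all 1 ≤ i ≤ n−1. -/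
open Matrix Polynomial
open scoped Classical

/-- The weighted Laplacian `W(υ)⁻¹ · L(ε)`, whose eigenvalues coincide with those of
the symmetric matrix `W(υ)^{-1/2} L(ε) W(υ)^{-1/2}`. -/
noncomputable def wlap {V : Type} [Fintype V] [DecidableEq V]
    (ε : V → V → ℝ) (υ : V → ℝ) : Matrix V V ℝ :=
  Matrix.diagonal (fun v => (υ v)⁻¹) * lapMat ε

/-- A family of fewer linear functionals than the dimension has a common nonzero zero. -/
theorem exists_ne_zero_forall_apply_eq_zero {K E ι : Type*} [Field K] [AddCommGroup E]
    [Module K E] [FiniteDimensional K E] [Fintype ι] (f : ι → E →ₗ[K] K)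
    (h : Fintype.card ι < Module.finrank K E) : ∃ x ≠ 0, ∀ i, f i x = 0 := by
  have hker : (LinearMap.pi f).ker ≠ ⊥ :=
    LinearMap.ker_ne_bot_of_finrank_lt (by simpa using h)
  obtain ⟨x, hx, hx0⟩ := Submodule.exists_mem_ne_zero_of_ne_bot hker
  exact ⟨x, hx0, fun i => congrFun (LinearMap.mem_ker.1 hx) i⟩

section Eigenbasis

variable {E ι : Type*} [NormedAddCommGroup E] [InnerProductSpace ℝ E] [Fintype ι]
  {T : E →ₗ[ℝ] E} {b : OrthonormalBasis ι ℝ E} {c : ι → ℝ} {t : ℝ} {x : E}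

theorem inner_apply_eq_sum_of_eigenbasis (hT : T.IsSymmetric) (hb : ∀ i, T (b i) = c i • b i)
    (x : E) : inner ℝ x (T x) = ∑ i, c i * inner ℝ (b i) x ^ 2 := by
  rw [← b.sum_inner_mul_inner]
  refine Finset.sum_congr rfl fun i _ => ?_
  rw [← hT (b i) x, hb i, real_inner_smul_left, real_inner_comm x (b i)]
  ring

theorem inner_apply_le_of_eigenbasis (hT : T.IsSymmetric) (hb : ∀ i, T (b i) = c i • b i)
    (h : ∀ i, t < c i → inner ℝ (b i) x = 0) : inner ℝ x (T x) ≤ t * ‖x‖ ^ 2 := by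
  rw [inner_apply_eq_sum_of_eigenbasis hT hb, ← b.sum_sq_norm_inner_right, Finset.mul_sum]
  refine Finset.sum_le_sum fun i _ => ?_
  rw [Real.norm_eq_abs, sq_abs]
  rcases le_or_gt (c i) t with hc | hc
  · gcongr
  · simp [h i hc]

theorem le_inner_apply_of_eigenbasis (hT : T.IsSymmetric) (hb : ∀ i, T (b i) = c i • b i)
    (h : ∀ i, c i < t → inner ℝ (b i) x = 0) : t * ‖x‖ ^ 2 ≤ inner ℝ x (T x) := by
  rw [inner_apply_eq_sum_of_eigenbasis hT hb, ← b.sum_sq_norm_inner_right, Finset.mul_sum]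
  refine Finset.sum_le_sum fun i _ => ?_
  rw [Real.norm_eq_abs, sq_abs]
  rcases le_or_gt t (c i) with hc | hc
  · gcongr
  · simp [h i hc]

end Eigenbasis

section RankOne

variable {E : Type*} [NormedAddCommGroup E] [InnerProductSpace ℝ E] {n : ℕ}
  {S T : E →ₗ[ℝ] E} {u w : OrthonormalBasis (Fin n) ℝ E} {lam mu : Fin n → ℝ}

/-- Weyl monotonicity: ordered eigenvalues are monotone in the quadratic form. -/
theorem eigenvalue_le_of_inner_le (hS : S.IsSymmetric) (hT : T.IsSymmetric)
    (hu : ∀ i, S (u i) = lam i • u i) (hw : ∀ i, T (w i) = mu i • w i)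
    (hlam : Monotone lam) (hmu : Monotone mu)
    (h : ∀ x, inner ℝ x (T x) ≤ inner ℝ x (S x)) (i : Fin n) : mu i ≤ lam i := by
  have : FiniteDimensional ℝ E := u.toBasis.finiteDimensional_of_finite
  have hrank : Module.finrank ℝ E = n := by simpa using Module.finrank_eq_card_basis u.toBasis
  obtain ⟨x, hx0, hx⟩ := exists_ne_zero_forall_apply_eq_zero
    (ι := Finset.Ioi i ⊕ Finset.Iio i)
    (Sum.elim (fun j => innerₛₗ ℝ (u j)) (fun j => innerₛₗ ℝ (w j))) (by
      simp only [Fintype.card_sum, Fintype.card_coe, Fin.card_Ioi, Fin.card_Iio, hrank]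
      omega)
  have hle := inner_apply_le_of_eigenbasis (t := lam i) (x := x) hS hu fun j hj =>
    hx (Sum.inl ⟨j, Finset.mem_Ioi.2 (hlam.reflect_lt hj)⟩)
  have hge := le_inner_apply_of_eigenbasis (t := mu i) (x := x) hT hw fun j hj =>
    hx (Sum.inr ⟨j, Finset.mem_Iio.2 (hmu.reflect_lt hj)⟩)
  exact le_of_mul_le_mul_right (hge.trans ((h x).trans hle)) (by positivity)

/-- If two quadratic forms agree on a hyperplane, the ordered eigenvalues of one are bounded by
the shifted ones of the other. -/
theorem eigenvalue_le_succ_of_inner_eq_on_ker (hS : S.IsSymmetric) (hT : T.IsSymmetric)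
    (hu : ∀ i, S (u i) = lam i • u i) (hw : ∀ i, T (w i) = mu i • w i)
    (hlam : Monotone lam) (hmu : Monotone mu) (f : E →ₗ[ℝ] ℝ)
    (h : ∀ x, f x = 0 → inner ℝ x (S x) = inner ℝ x (T x)) {i j : Fin n}
    (hij : (j : ℕ) = i + 1) : lam i ≤ mu j := by
  have : FiniteDimensional ℝ E := u.toBasis.finiteDimensional_of_finite
  have hrank : Module.finrank ℝ E = n := by simpa using Module.finrank_eq_card_basis u.toBasis
  obtain ⟨x, hx0, hx⟩ := exists_ne_zero_forall_apply_eq_zero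
    (ι := (Finset.Iio i ⊕ Finset.Ioi j) ⊕ Unit)
    (Sum.elim (Sum.elim (fun k => innerₛₗ ℝ (u k)) (fun k => innerₛₗ ℝ (w k))) fun _ => f) (by
      simp only [Fintype.card_sum, Fintype.card_coe, Fin.card_Ioi, Fin.card_Iio, hrank,
        Fintype.card_unit]
      omega)
  have hge := le_inner_apply_of_eigenbasis (t := lam i) (x := x) hS hu fun k hk =>
    hx (Sum.inl (Sum.inl ⟨k, Finset.mem_Iio.2 (hlam.reflect_lt hk)⟩))
  have hle := inner_apply_le_of_eigenbasis (t := mu j) (x := x) hT hw fun k hk =>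
    hx (Sum.inl (Sum.inr ⟨k, Finset.mem_Ioi.2 (hmu.reflect_lt hk)⟩))
  rw [h x (hx (Sum.inr ()))] at hge
  exact le_of_mul_le_mul_right (hge.trans hle) (by positivity)

end RankOne

/-- A real symmetric matrix has an orthonormal eigenbasis ordered as any given monotone
enumeration of the roots of its characteristic polynomial. -/
theorem Matrix.IsHermitian.exists_eigenbasis_of_charpoly_eq {V : Type*} [Fintype V]
    [DecidableEq V] {A : Matrix V V ℝ} (hA : A.IsHermitian) {lam : Fin (Fintype.card V) → ℝ}
    (hmono : Monotone lam) (hlam : A.charpoly = ∏ i, (X - C (lam i))) :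
    ∃ u : OrthonormalBasis (Fin (Fintype.card V)) ℝ (EuclideanSpace ℝ V),
      ∀ i, A.toEuclideanLin (u i) = lam i • u i := by
  have hroots : A.charpoly.roots = Multiset.map lam Finset.univ.val := by
    rw [hlam, Polynomial.roots_prod]
    · simp
    · simp [Finset.prod_ne_zero_iff, Polynomial.X_sub_C_ne_zero]
  have hrev : Monotone (hA.eigenvalues₀ ∘ Fin.rev) := fun i j hij =>
    hA.eigenvalues₀_antitone (Fin.rev_le_rev.2 hij)
  have heq : lam = hA.eigenvalues₀ ∘ Fin.rev := by
    rw [← List.ofFn_inj]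
    refine List.Perm.eq_of_sortedLE hmono.sortedLE_ofFn hrev.sortedLE_ofFn ?_
    rw [← Multiset.coe_eq_coe, ← Fin.univ_val_map, ← Fin.univ_val_map, ← hroots,
      hA.roots_charpoly_eq_eigenvalues₀, ← Multiset.map_map hA.eigenvalues₀ Fin.rev,
      show Multiset.map Fin.rev Finset.univ.val = Finset.univ.val from
        Multiset.map_univ_val_equiv Fin.revPerm]
    rfl
  let e : V ≃ Fin (Fintype.card V) :=
    (Fintype.equivOfCardEq (Fintype.card_fin _)).symm.trans Fin.revPerm
  refine ⟨hA.eigenvectorBasis.reindex e, fun i => ?_⟩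
  have hval : hA.eigenvalues (e.symm i) = lam i := by
    simp [heq, e, Matrix.IsHermitian.eigenvalues]
  rw [OrthonormalBasis.reindex_apply, ← hval]
  ext v
  simpa using congrFun (hA.mulVec_eigenvectorBasis (e.symm i)) v

section Laplacian

variable {V : Type} [Fintype V] [DecidableEq V]

/-- The symmetric matrix `W(υ)^{-1/2} L(ε) W(υ)^{-1/2}`. -/
noncomputable def symmWlap (ε : V → V → ℝ) (υ : V → ℝ) : Matrix V V ℝ :=
  Matrix.diagonal (fun v => (√(υ v))⁻¹) * lapMat ε * Matrix.diagonal (fun v => (√(υ v))⁻¹)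

theorem isHermitian_symmWlap {ε : V → V → ℝ} (hε : ∀ u v, ε u v = ε v u) (υ : V → ℝ) :
    (symmWlap ε υ).IsHermitian := by
  have hL : (lapMat ε)ᵀ = lapMat ε := by
    ext u v
    simp [lapMat, hε u v, Matrix.diagonal_apply, eq_comm (a := u)]
    aesop
  simp [Matrix.IsHermitian, symmWlap, Matrix.conjTranspose_eq_transpose_of_trivial,
    Matrix.transpose_mul, hL, Matrix.mul_assoc]

theorem charpoly_symmWlap (ε : V → V → ℝ) {υ : V → ℝ} (hυ : ∀ v, 0 < υ v) :
    (symmWlap ε υ).charpoly = (wlap ε υ).charpoly := by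
  rw [symmWlap, Matrix.charpoly_mul_comm, ← Matrix.mul_assoc, Matrix.diagonal_mul_diagonal, wlap]
  simp [← mul_inv, Real.mul_self_sqrt (hυ _).le]

theorem lapMat_eq_add_of_edge_deletion {ε εdel : V → V → ℝ} (hε : ∀ u v, ε u v = ε v u) {a b : V}
    (hab : a ≠ b)
    (hdel : εdel = fun u v => if (u = a ∧ v = b) ∨ (u = b ∧ v = a) then 0 else ε u v) :
    lapMat ε = lapMat εdel + ε a b •
      Matrix.vecMulVec (Pi.single a 1 - Pi.single b 1) (Pi.single a 1 - Pi.single b 1) := by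
  have hsum : ∀ u, ∑ v, ε u v = ∑ v, εdel u v +
      ε a b * ((Pi.single a 1 : V → ℝ) u + (Pi.single b 1 : V → ℝ) u) := by
    intro u
    have hadd : ∀ v, ε u v = εdel u v +
        ε a b * ((Pi.single a 1 : V → ℝ) u * (Pi.single b 1 : V → ℝ) v +
          (Pi.single b 1 : V → ℝ) u * (Pi.single a 1 : V → ℝ) v) := by
      intro v
      have := hε a b
      simp only [hdel, Pi.single_apply]
      grind
    rw [Finset.sum_congr rfl fun v _ => hadd v, Finset.sum_add_distrib, ← Finset.mul_sum,
      Finset.sum_add_distrib, ← Finset.mul_sum, ← Finset.mul_sum]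
    simp
  ext u v
  have := hε a b
  simp only [lapMat, Matrix.add_apply, Matrix.sub_apply, Matrix.diagonal_apply, Matrix.of_apply,
    Matrix.smul_apply, Matrix.vecMulVec_apply, Pi.sub_apply, smul_eq_mul, hsum u]
  simp only [hdel, Pi.single_apply]
  grind

theorem inner_symmWlap_of_edge_deletion {ε εdel : V → V → ℝ} (hε : ∀ u v, ε u v = ε v u)
    {a b : V} (hab : a ≠ b)
    (hdel : εdel = fun u v => if (u = a ∧ v = b) ∨ (u = b ∧ v = a) then 0 else ε u v)
    (υ : V → ℝ) (x : EuclideanSpace ℝ V) :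
    inner ℝ x ((symmWlap ε υ).toEuclideanLin x) =
      inner ℝ x ((symmWlap εdel υ).toEuclideanLin x) +
        ε a b * ((√(υ a))⁻¹ * x a - (√(υ b))⁻¹ * x b) ^ 2 := by
  simp only [symmWlap, lapMat_eq_add_of_edge_deletion hε hab hdel, Matrix.mul_add, Matrix.add_mul,
    map_add, LinearMap.add_apply, inner_add_right]
  congr 1
  simp [EuclideanSpace.inner_eq_star_dotProduct, Matrix.toLpLin_apply, -Matrix.mulVec_mulVec,
    Matrix.vecMulVec_mulVec, sub_dotProduct, Matrix.mulVec_sub, Matrix.mulVec_diagonal]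
  left
  ring

end Laplacian

/-- **Interlacing under edge deletion**: the weighted Laplacian eigenvalues of
`(G - e, υ, ε)` interlace those of `(G, υ, ε)`. -/
theorem interlacing_edge_deletion
    {V : Type} [Fintype V] [DecidableEq V]
    (ε : V → V → ℝ) (hsym : ∀ u v, ε u v = ε v u)
    (hnonneg : ∀ u v, 0 ≤ ε u v) (hdiag : ∀ v, ε v v = 0)
    (υ : V → ℝ) (hυ : ∀ v, 0 < υ v)
    (n : ℕ) (hn : n = Fintype.card V)
    (a b : V) (hab : a ≠ b) (hεab : 0 < ε a b)
    (εdel : V → V → ℝ)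
    (hdel : εdel = fun u v => if (u = a ∧ v = b) ∨ (u = b ∧ v = a) then 0 else ε u v)
    (lam mu : Fin n → ℝ) (hlamMono : Monotone lam) (hmuMono : Monotone mu)
    (hlam : (wlap ε υ).charpoly = ∏ i, (X - C (lam i)))
    (hmu : (wlap εdel υ).charpoly = ∏ i, (X - C (mu i))) :
    (∀ i, mu i ≤ lam i) ∧
      (∀ i : Fin n, ∀ h : (i : ℕ) + 1 < n, lam i ≤ mu ⟨(i : ℕ) + 1, h⟩) := by
  subst hn
  have hdelsym : ∀ u v, εdel u v = εdel v u := by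
    intro u v
    have := hsym u v
    simp only [hdel]
    grind
  have hS := isHermitian_symmWlap hsym υ
  have hT := isHermitian_symmWlap hdelsym υ
  obtain ⟨u, hu⟩ := hS.exists_eigenbasis_of_charpoly_eq hlamMono
    ((charpoly_symmWlap ε hυ).trans hlam)
  obtain ⟨w, hw⟩ := hT.exists_eigenbasis_of_charpoly_eq hmuMono
    ((charpoly_symmWlap εdel hυ).trans hmu)
  have hS' := Matrix.isSymmetric_toEuclideanLin_iff.2 hS
  have hT' := Matrix.isSymmetric_toEuclideanLin_iff.2 hT
  have hform := inner_symmWlap_of_edge_deletion hsym hab hdel υ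
  refine ⟨eigenvalue_le_of_inner_le hS' hT' hu hw hlamMono hmuMono fun x => ?_, fun i h => ?_⟩
  · rw [hform x]
    exact le_add_of_nonneg_right (by positivity)
  · refine eigenvalue_le_succ_of_inner_eq_on_ker hS' hT' hu hw hlamMono hmuMono
      ((√(υ a))⁻¹ • (EuclideanSpace.proj a : EuclideanSpace ℝ V →L[ℝ] ℝ).toLinearMap -
        (√(υ b))⁻¹ • (EuclideanSpace.proj b : EuclideanSpace ℝ V →L[ℝ] ℝ).toLinearMap)
      (fun x hx => ?_) rfl
    have hx' : (√(υ a))⁻¹ * x a - (√(υ b))⁻¹ * x b = 0 := by simpa using hx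
    rw [hform x, hx']
    simp
end

section
/- Let ε be an edge-weight function and υ a vertex-weight function on a finite set V with n = |V|, and let a ≠ b be vertices with ε(a,b) > 0. Let ε_del agree with ε except that ε_del(a,b) = ε_del(b,a) = 0, and let (ε_con, υ_con) be the contraction on V' = V ∖ {b} given by υ_con(a) = υ(a) + υ(b), υ_con(x) = υ(x) for x ≠ a, ε_con(x,y) = ε(x,y) for distinct x,y ≠ a, ε_con(x,a) = ε_con(a,x) = ε(x,a) + ε(x,b) for x ≠ a, and ε_con(x,x) = 0. Let λ_1 ≤ … ≤ λ_n, μ_1 ≤ … ≤ μ_n, and ν_1 ≤ … ≤ ν_{n−1} denote the weighted Laplacian eigenvalues of (ε,υ), (ε_del,υ), and (ε_con,υ_con), respectively. Then μ_i ≤ λ_i for all 1 ≤ i ≤ n, and λ_i ≤ ν_i ≤ μ_{i+1} for all 1 ≤ i ≤ n−1. -/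
open Matrix Polynomial
open scoped Classical

section Interlacing

lemma card_fiber_eq_count_roots {ι : Type*} [Fintype ι] (f : ι → ℝ) (x : ℝ) :
    Fintype.card {i // f i = x} = (∏ i, (X - C (f i))).roots.count x := by
  have hroots : (∏ i, (X - C (f i))).roots = Finset.univ.val.map f := by
    rw [Polynomial.roots_prod _ _ (by simp [Finset.prod_ne_zero_iff, X_sub_C_ne_zero])]
    simp
  rw [hroots, Multiset.count_map, Fintype.card_subtype, Finset.card_def, Finset.filter_val]
  simp only [eq_comm]

/-- Two finite families of reals with the same monic split polynomial agree up to reindexing. -/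
lemma exists_equiv_of_prod_X_sub_C_eq {ι κ : Type*} [Fintype ι] [Fintype κ]
    (f : ι → ℝ) (g : κ → ℝ) (h : ∏ i, (X - C (f i)) = ∏ j, (X - C (g j))) :
    ∃ σ : ι ≃ κ, ∀ i, g (σ i) = f i := by
  have e (x : ℝ) : Nonempty ({i // f i = x} ≃ {j // g j = x}) := by
    rw [← Fintype.card_eq, card_fiber_eq_count_roots f, card_fiber_eq_count_roots g, h]
  exact ⟨Equiv.ofFiberEquiv fun x => (e x).some, fun i => Equiv.ofFiberEquiv_map _ i⟩

/-- Comparison of sorted eigenvalues of two diagonal quadratic forms along a linear map which,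
on a subspace cut out by `k` equations, is isometric and does not increase the form. -/
lemma eigenvalue_le_of_form_le {m n k : ℕ} (lam : Fin n → ℝ) (mu : Fin m → ℝ)
    (hlam : Monotone lam) (hmu : Monotone mu)
    (T : (Fin m → ℝ) →ₗ[ℝ] (Fin n → ℝ)) (g : (Fin m → ℝ) →ₗ[ℝ] (Fin k → ℝ))
    (hN : ∀ c, g c = 0 → ∑ i, T c i ^ 2 = ∑ i, c i ^ 2)
    (hq : ∀ c, g c = 0 → ∑ i, lam i * T c i ^ 2 ≤ ∑ i, mu i * c i ^ 2)
    (i : Fin n) (j : Fin m) (hij : (i : ℕ) + k = j) : lam i ≤ mu j := by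
  let Φ : (Fin m → ℝ) →ₗ[ℝ] (({l : Fin n // l < i} → ℝ) × (Fin k → ℝ)) ×
      ({l : Fin m // j < l} → ℝ) :=
    (((LinearMap.funLeft ℝ ℝ Subtype.val).comp T).prod g).prod (LinearMap.funLeft ℝ ℝ Subtype.val)
  have hker : Φ.ker ≠ ⊥ := by
    apply LinearMap.ker_ne_bot_of_finrank_lt
    have := j.2
    simp [Fintype.card_subtype, Finset.filter_lt_eq_Ioi, Finset.filter_gt_eq_Iio]
    omega
  obtain ⟨c, hc, hc0⟩ := Submodule.exists_mem_ne_zero_of_ne_bot hker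
  have hΦ : Φ c = 0 := hc
  obtain ⟨h12, h3⟩ := Prod.mk_eq_zero.mp hΦ
  obtain ⟨h1, h2⟩ := Prod.mk_eq_zero.mp h12
  have h1' (l : Fin n) (hl : l < i) : T c l = 0 := congrFun h1 ⟨l, hl⟩
  have h3' (l : Fin m) (hl : j < l) : c l = 0 := congrFun h3 ⟨l, hl⟩
  have hpos : 0 < ∑ l, c l ^ 2 := by
    obtain ⟨l, hl⟩ := Function.ne_iff.mp hc0
    exact Finset.sum_pos' (fun _ _ => sq_nonneg _) ⟨l, Finset.mem_univ _, sq_pos_of_ne_zero hl⟩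
  have hlow : lam i * ∑ l, T c l ^ 2 ≤ ∑ l, lam l * T c l ^ 2 := by
    rw [Finset.mul_sum]
    refine Finset.sum_le_sum fun l _ => ?_
    rcases lt_or_ge l i with hl | hl
    · simp [h1' l hl]
    · exact mul_le_mul_of_nonneg_right (hlam hl) (sq_nonneg _)
  have hhigh : ∑ l, mu l * c l ^ 2 ≤ mu j * ∑ l, c l ^ 2 := by
    rw [Finset.mul_sum]
    refine Finset.sum_le_sum fun l _ => ?_
    rcases lt_or_ge j l with hl | hl
    · simp [h3' l hl]
    · exact mul_le_mul_of_nonneg_right (hmu hl) (sq_nonneg _)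
  refine le_of_mul_le_mul_right ?_ hpos
  calc lam i * ∑ l, c l ^ 2 = lam i * ∑ l, T c l ^ 2 := by rw [hN c h2]
    _ ≤ _ := (hlow.trans (hq c h2)).trans hhigh

variable {V : Type} [Fintype V] [DecidableEq V]

/-- Twice the Dirichlet form of an edge-weight function. -/
def dirichletSum (ε : V → V → ℝ) (f : V → ℝ) : ℝ := ∑ u, ∑ v, ε u v * (f u - f v) ^ 2

lemma lapMat_transpose {ε : V → V → ℝ} (hsym : ∀ u v, ε u v = ε v u) :
    (lapMat ε)ᵀ = lapMat ε := by
  rw [lapMat, transpose_sub, diagonal_transpose]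
  congr 1
  ext u v
  exact hsym v u

lemma two_mul_dotProduct_lapMat_mulVec {ε : V → V → ℝ} (hsym : ∀ u v, ε u v = ε v u)
    (f : V → ℝ) : 2 * (f ⬝ᵥ (lapMat ε *ᵥ f)) = dirichletSum ε f := by
  have h1 : f ⬝ᵥ (lapMat ε *ᵥ f) = ∑ u, ∑ v, ε u v * (f u ^ 2 - f u * f v) := by
    rw [lapMat, sub_mulVec, dotProduct]
    refine Finset.sum_congr rfl fun u _ => ?_
    rw [Pi.sub_apply, mulVec_diagonal, mulVec, dotProduct, Finset.sum_mul,
      ← Finset.sum_sub_distrib, Finset.mul_sum]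
    refine Finset.sum_congr rfl fun v _ => ?_
    rw [of_apply]
    ring
  have h2 : f ⬝ᵥ (lapMat ε *ᵥ f) = ∑ u, ∑ v, ε u v * (f v ^ 2 - f u * f v) := by
    rw [h1, Finset.sum_comm]
    refine Finset.sum_congr rfl fun u _ => Finset.sum_congr rfl fun v _ => ?_
    rw [hsym v u]; ring
  rw [two_mul]
  nth_rewrite 1 [h1]
  rw [h2]
  simp only [dirichletSum, ← Finset.sum_add_distrib]
  refine Finset.sum_congr rfl fun u _ => Finset.sum_congr rfl fun v _ => by ring

/-- Coordinates diagonalizing simultaneously the Dirichlet form and the vertex-weighted norm. -/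
lemma exists_diagonalizing_equiv {ε : V → V → ℝ} (hsym : ∀ u v, ε u v = ε v u)
    {υ : V → ℝ} (hυ : ∀ v, 0 < υ v) {n : ℕ} (lam : Fin n → ℝ)
    (hlam : (wlap ε υ).charpoly = ∏ i, (X - C (lam i))) :
    ∃ φ : (Fin n → ℝ) ≃ₗ[ℝ] (V → ℝ), ∀ c,
      dirichletSum ε (φ c) = 2 * ∑ i, lam i * c i ^ 2 ∧
      ∑ v, υ v * φ c v ^ 2 = ∑ i, c i ^ 2 := by
  let s : V → ℝ := fun v => (√(υ v))⁻¹
  have hs (v : V) : s v * s v = (υ v)⁻¹ := by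
    simp only [s]; rw [← mul_inv, Real.mul_self_sqrt (hυ v).le]
  let D : Matrix V V ℝ := diagonal s
  have hA : (D * lapMat ε * D).IsHermitian := by
    simp [IsHermitian, D, conjTranspose_eq_transpose_of_trivial, transpose_mul,
      lapMat_transpose hsym, Matrix.mul_assoc]
  have hwlap : wlap ε υ = D * (D * lapMat ε) := by
    rw [← Matrix.mul_assoc, diagonal_mul_diagonal]
    simp only [wlap, hs]
  have hchar : ∏ i, (X - C (lam i)) = ∏ v, (X - C (hA.eigenvalues v)) := by
    rw [← hlam, hwlap, charpoly_mul_comm]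
    exact hA.charpoly_eq
  obtain ⟨σ, hσ⟩ := exists_equiv_of_prod_X_sub_C_eq _ _ hchar
  let U : Matrix V V ℝ := hA.eigenvectorUnitary
  have hU : Uᵀ * U = 1 := by
    have := Unitary.coe_star_mul_self hA.eigenvectorUnitary
    rwa [star_eq_conjTranspose, conjTranspose_eq_transpose_of_trivial] at this
  have hUA : Uᵀ * (D * lapMat ε * D) * U = diagonal hA.eigenvalues := by
    have := hA.conjStarAlgAut_star_eigenvectorUnitary
    rw [Unitary.conjStarAlgAut_star_apply, star_eq_conjTranspose,
      conjTranspose_eq_transpose_of_trivial] at this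
    exact this
  let φ : (Fin n → ℝ) →ₗ[ℝ] (V → ℝ) := (D * U).mulVecLin.comp (LinearMap.funLeft ℝ ℝ σ.symm)
  have hφ (c : Fin n → ℝ) : φ c = (D * U) *ᵥ (c ∘ σ.symm) := rfl
  have hform (M : Matrix V V ℝ) (x : V → ℝ) :
      ((D * U) *ᵥ x) ⬝ᵥ (M *ᵥ ((D * U) *ᵥ x)) = x ⬝ᵥ ((Uᵀ * (D * M * D) * U) *ᵥ x) := by
    rw [mulVec_mulVec, ← vecMul_transpose, ← dotProduct_mulVec, mulVec_mulVec]
    simp [D, transpose_mul, Matrix.mul_assoc]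
  have hdiag (w x : V → ℝ) : x ⬝ᵥ (diagonal w *ᵥ x) = ∑ v, w v * x v ^ 2 := by
    simp only [dotProduct, mulVec_diagonal]
    exact Finset.sum_congr rfl fun v _ => by ring
  have hN (c : Fin n → ℝ) : ∑ v, υ v * φ c v ^ 2 = ∑ i, c i ^ 2 := by
    have hDWD : D * diagonal υ * D = 1 := by
      simp only [D, diagonal_mul_diagonal]
      rw [← diagonal_one]
      congr 1
      ext v
      rw [mul_right_comm, hs, inv_mul_cancel₀ (hυ v).ne']
    rw [← hdiag, hφ, hform, hDWD, Matrix.mul_one, hU, ← diagonal_one, hdiag]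
    rw [← Equiv.sum_comp σ]
    simp
  have hinj : Function.Injective φ := by
    rw [← LinearMap.ker_eq_bot, LinearMap.ker_eq_bot']
    intro c hc
    have h := hN c
    rw [hc] at h
    ext i
    have h0 := (Finset.sum_eq_zero_iff_of_nonneg (fun i _ => sq_nonneg (c i))).mp
      (by simpa using h.symm) i (Finset.mem_univ i)
    simpa using h0
  have hcard : Module.finrank ℝ (Fin n → ℝ) = Module.finrank ℝ (V → ℝ) := by
    simpa using Fintype.card_congr σ
  refine ⟨LinearMap.linearEquivOfInjective φ hinj hcard, fun c => ?_⟩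
  rw [LinearMap.linearEquivOfInjective_apply]
  refine ⟨?_, hN c⟩
  rw [← two_mul_dotProduct_lapMat_mulVec hsym, hφ, hform, hUA, hdiag, ← Equiv.sum_comp σ]
  simp [hσ]

/-- Sorted weighted Laplacian eigenvalues compare along a linear map of functions which, on the
kernel of `k` linear equations, preserves the weighted norm and does not increase the Dirichlet
form. -/
lemma wlap_eigenvalue_le {V' : Type} [Fintype V'] [DecidableEq V']
    {ε : V → V → ℝ} (hsym : ∀ u v, ε u v = ε v u) {υ : V → ℝ} (hυ : ∀ v, 0 < υ v)
    {ε' : V' → V' → ℝ} (hsym' : ∀ u v, ε' u v = ε' v u) {υ' : V' → ℝ} (hυ' : ∀ v, 0 < υ' v)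
    {m n k : ℕ} {lam : Fin n → ℝ} {mu : Fin m → ℝ} (hlamMono : Monotone lam)
    (hmuMono : Monotone mu) (hlam : (wlap ε υ).charpoly = ∏ i, (X - C (lam i)))
    (hmu : (wlap ε' υ').charpoly = ∏ i, (X - C (mu i)))
    (T : (V' → ℝ) →ₗ[ℝ] (V → ℝ)) (g : (V' → ℝ) →ₗ[ℝ] (Fin k → ℝ))
    (hN : ∀ f, g f = 0 → ∑ v, υ v * T f v ^ 2 = ∑ v, υ' v * f v ^ 2)
    (hq : ∀ f, g f = 0 → dirichletSum ε (T f) ≤ dirichletSum ε' f)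
    (i : Fin n) (j : Fin m) (hij : (i : ℕ) + k = j) : lam i ≤ mu j := by
  obtain ⟨φ, hφ⟩ := exists_diagonalizing_equiv hsym hυ lam hlam
  obtain ⟨ψ, hψ⟩ := exists_diagonalizing_equiv hsym' hυ' mu hmu
  refine eigenvalue_le_of_form_le lam mu hlamMono hmuMono
    (φ.symm.toLinearMap ∘ₗ T ∘ₗ ψ.toLinearMap) (g ∘ₗ ψ.toLinearMap)
    (fun c hc => ?_) (fun c hc => ?_) i j hij
  · have h := hN (ψ c) hc
    rw [(hψ c).2, ← φ.apply_symm_apply (T (ψ c)), (hφ _).2] at h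
    exact h
  · have h := hq (ψ c) hc
    rw [(hψ c).1, ← φ.apply_symm_apply (T (ψ c)), (hφ _).1] at h
    exact le_of_mul_le_mul_left h two_pos

lemma dirichletSum_contraction {ε : V → V → ℝ} (hsym : ∀ u v, ε u v = ε v u) {a b : V}
    (hab : a ≠ b) {εcon : {x : V // x ≠ b} → {x : V // x ≠ b} → ℝ}
    (hεcon : εcon = fun x y =>
      if x = y then 0
      else if x.1 = a then ε y.1 a + ε y.1 b
      else if y.1 = a then ε x.1 a + ε x.1 b
      else ε x.1 y.1)
    (f : V → ℝ) (hf : f a = f b) :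
    dirichletSum εcon (fun x => f x) = dirichletSum ε f := by
  have hpt (x y : {x : V // x ≠ b}) : εcon x y * (f x - f y) ^ 2 =
      ε x y * (f x - f y) ^ 2 + (if x = ⟨a, hab⟩ then ε b y * (f b - f y) ^ 2 else 0) +
        (if y = ⟨a, hab⟩ then ε x b * (f x - f b) ^ 2 else 0) := by
    rw [hεcon]
    rcases eq_or_ne x y with rfl | hxy
    · rcases eq_or_ne x ⟨a, hab⟩ with rfl | hx
      · simp [hf]
      · simp [hx]
    · rcases eq_or_ne x ⟨a, hab⟩ with rfl | hx
      · simp only [hxy, hxy.symm, if_true, if_false, hf, hsym y.1]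
        ring
      · rcases eq_or_ne y ⟨a, hab⟩ with rfl | hy
        · have : x.1 ≠ a := fun h => hx (Subtype.ext h)
          simp only [hxy, this, if_true, if_false, hf]
          ring
        · have h1 : x.1 ≠ a := fun h => hx (Subtype.ext h)
          have h2 : y.1 ≠ a := fun h => hy (Subtype.ext h)
          simp [hxy, h1, h2, hx, hy]
  simp only [dirichletSum, hpt]
  rw [Fintype.sum_eq_add_sum_subtype_ne _ b]
  simp only [Fintype.sum_eq_add_sum_subtype_ne _ b, Finset.sum_add_distrib, Finset.sum_ite_eq',
    Finset.mem_univ, if_true, sub_self]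
  simp only [Finset.sum_ite_irrel, Finset.sum_const_zero, Finset.sum_ite_eq', Finset.mem_univ,
    if_true]
  ring

lemma sum_contraction {υ : V → ℝ} {a b : V} (hab : a ≠ b) {υcon : {x : V // x ≠ b} → ℝ}
    (hυcon : υcon = fun x => if x.1 = a then υ a + υ b else υ x.1)
    (f : V → ℝ) (hf : f a = f b) :
    ∑ x, υcon x * f x ^ 2 = ∑ v, υ v * f v ^ 2 := by
  have hpt (x : {x : V // x ≠ b}) : υcon x * f x ^ 2 =
      υ x * f x ^ 2 + if x = ⟨a, hab⟩ then υ b * f b ^ 2 else 0 := by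
    rw [hυcon]
    rcases eq_or_ne x ⟨a, hab⟩ with rfl | hx
    · simp only [if_true, hf]
      ring
    · have h1 : x.1 ≠ a := fun h => hx (Subtype.ext h)
      simp [h1, hx]
  simp only [hpt]
  rw [Fintype.sum_eq_add_sum_subtype_ne _ b, Finset.sum_add_distrib]
  simp [add_comm]

end Interlacing

/-- **Deletion-contraction interlacing**: the weighted Laplacian eigenvalues of the
contraction `(G/e, υ/e, ε)` interlace those of `(G, υ, ε)` and `(G - e, υ, ε)`:
`μ₁ ≤ λ₁ ≤ ν₁ ≤ … ≤ ν_{n-1} ≤ μₙ ≤ λₙ`. -/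
theorem interlacing_deletion_contraction
    {V : Type} [Fintype V] [DecidableEq V]
    (ε : V → V → ℝ) (hsym : ∀ u v, ε u v = ε v u)
    (hnonneg : ∀ u v, 0 ≤ ε u v) (hdiag : ∀ v, ε v v = 0)
    (υ : V → ℝ) (hυ : ∀ v, 0 < υ v)
    (n : ℕ) (hn : n = Fintype.card V)
    (a b : V) (hab : a ≠ b) (hεab : 0 < ε a b)
    (εdel : V → V → ℝ)
    (hdel : εdel = fun u v => if (u = a ∧ v = b) ∨ (u = b ∧ v = a) then 0 else ε u v)
    (υcon : {x : V // x ≠ b} → ℝ)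
    (hυcon : υcon = fun x => if x.1 = a then υ a + υ b else υ x.1)
    (εcon : {x : V // x ≠ b} → {x : V // x ≠ b} → ℝ)
    (hεcon : εcon = fun x y =>
      if x = y then 0
      else if x.1 = a then ε y.1 a + ε y.1 b
      else if y.1 = a then ε x.1 a + ε x.1 b
      else ε x.1 y.1)
    (lam mu : Fin n → ℝ) (nu : Fin (n - 1) → ℝ)
    (hlamMono : Monotone lam) (hmuMono : Monotone mu) (hnuMono : Monotone nu)
    (hlam : (wlap ε υ).charpoly = ∏ i, (X - C (lam i)))
    (hmu : (wlap εdel υ).charpoly = ∏ i, (X - C (mu i)))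
    (hnu : (wlap εcon υcon).charpoly = ∏ i, (X - C (nu i))) :
    (∀ i, mu i ≤ lam i) ∧
      (∀ i : Fin (n - 1),
        lam ⟨(i : ℕ), by have := i.2; omega⟩ ≤ nu i ∧
        nu i ≤ mu ⟨(i : ℕ) + 1, by have := i.2; omega⟩) := by
  have hdelsym : ∀ u v, εdel u v = εdel v u := by
    intro u v
    simp only [hdel, hsym u v]
    congr 1
    exact propext ⟨by tauto, by tauto⟩
  have hconsym : ∀ x y, εcon x y = εcon y x := by
    intro x y
    rcases eq_or_ne x y with rfl | hxy
    · rfl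
    · have : ¬ (x.1 = a ∧ y.1 = a) := fun h => hxy (Subtype.ext (h.1.trans h.2.symm))
      simp only [hεcon, hxy, hxy.symm, if_false, hsym x.1 y.1]
      split_ifs <;> tauto
  have hυconpos : ∀ x, 0 < υcon x := by
    intro x
    simp only [hυcon]
    split_ifs
    · exact add_pos (hυ a) (hυ b)
    · exact hυ _
  have hdel_le (f : V → ℝ) : dirichletSum εdel f ≤ dirichletSum ε f := by
    refine Finset.sum_le_sum fun u _ => Finset.sum_le_sum fun v _ =>
      mul_le_mul_of_nonneg_right ?_ (sq_nonneg _)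
    simp only [hdel]
    split_ifs
    exacts [hnonneg u v, le_rfl]
  have hdel_eq (f : V → ℝ) (hf : f a = f b) : dirichletSum εdel f = dirichletSum ε f := by
    refine Finset.sum_congr rfl fun u _ => Finset.sum_congr rfl fun v _ => ?_
    simp only [hdel]
    split_ifs with h
    · rcases h with ⟨rfl, rfl⟩ | ⟨rfl, rfl⟩ <;> simp [hf]
    · rfl
  refine ⟨fun i => ?_, fun i => ⟨?_, ?_⟩⟩
  · exact wlap_eigenvalue_le hdelsym hυ hsym hυ hmuMono hlamMono hmu hlam LinearMap.id
      (0 : _ →ₗ[ℝ] (Fin 0 → ℝ)) (fun _ _ => rfl) (fun f _ => hdel_le f) i i rfl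
  · let r : V → {x : V // x ≠ b} := fun v => if h : v = b then ⟨a, hab⟩ else ⟨v, h⟩
    have hra : r a = ⟨a, hab⟩ := dif_neg hab
    have hrb : r b = ⟨a, hab⟩ := dif_pos rfl
    have hr (x : {x : V // x ≠ b}) : r x = x := dif_neg x.2
    have hfab (f : {x : V // x ≠ b} → ℝ) : (f ∘ r) a = (f ∘ r) b := by
      simp only [Function.comp_apply, hra, hrb]
    refine wlap_eigenvalue_le hsym hυ hconsym hυconpos hlamMono hnuMono hlam hnu
      (LinearMap.funLeft ℝ ℝ r) (0 : _ →ₗ[ℝ] (Fin 0 → ℝ))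
      (fun f _ => ?_) (fun f _ => ?_) _ i rfl
    · have h := sum_contraction hab hυcon (f ∘ r) (hfab f)
      simp only [Function.comp_apply, hr] at h
      exact h.symm
    · have h := dirichletSum_contraction hsym hab hεcon (f ∘ r) (hfab f)
      simp only [Function.comp_apply, hr] at h
      exact h.symm.le
  · let g : (V → ℝ) →ₗ[ℝ] (Fin 1 → ℝ) :=
      LinearMap.funLeft ℝ ℝ (fun _ => a) - LinearMap.funLeft ℝ ℝ (fun _ => b)
    have hfab (f : V → ℝ) (hf : g f = 0) : f a = f b := sub_eq_zero.mp (congrFun hf 0)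
    refine wlap_eigenvalue_le hconsym hυconpos hdelsym hυ hnuMono hmuMono hnu hmu
      (LinearMap.funLeft ℝ ℝ Subtype.val) g
      (fun f hf => ?_) (fun f hf => ?_) i _ rfl
    · exact sum_contraction hab hυcon f (hfab f hf)
    · rw [hdel_eq f (hfab f hf)]
      exact (dirichletSum_contraction hsym hab hεcon f (hfab f hf)).le
end

section
/- Let ε be an edge-weight function and υ a vertex-weight function on a finite set V with n = |V|, let V' be a finite set with |V'| = n − k, and let q : V → V' be a surjection. Define quotient weights on V' by υ_q(x) = ∑_{v : q(v) = x} υ(v) and ε_q(x,y) = ∑_{u : q(u) = x} ∑_{v : q(v) = y} ε(u,v) for x ≠ y, with ε_q(x,x) = 0. Let λ_1 ≤ … ≤ λ_n and μ_1 ≤ … ≤ μ_{n−k} denote the weighted Laplacian eigenvalues of (ε,υ) and (ε_q,υ_q), respectively. Then λ_i ≤ μ_i ≤ λ_{i+k} for all 1 ≤ i ≤ n−k. -/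
open Matrix Polynomial
open scoped Classical

/-- If two families of linear forms on `E` express the same pair of quadratic forms as weighted
sums of squares, then the weights of the two families are related by a dimension count. -/
lemma le_of_card_add_card_lt_finrank {E ι κ : Type*} [AddCommGroup E] [Module ℝ E]
    [Fintype ι] [Fintype κ] (e : E →ₗ[ℝ] ι → ℝ) (f : E →ₗ[ℝ] κ → ℝ)
    (he : Function.Injective e) (a : ι → ℝ) (b : κ → ℝ)
    (hnorm : ∀ x, ∑ i, e x i ^ 2 = ∑ j, f x j ^ 2)
    (hform : ∀ x, ∑ i, a i * e x i ^ 2 = ∑ j, b j * f x j ^ 2) (s t : ℝ)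
    (hcard : Fintype.card {i // s < a i} + Fintype.card {j // b j < t} < Module.finrank ℝ E) :
    t ≤ s := by
  have : FiniteDimensional ℝ E := FiniteDimensional.of_injective e he
  let g : E →ₗ[ℝ] ({i // s < a i} → ℝ) × ({j // b j < t} → ℝ) :=
    ((LinearMap.funLeft ℝ ℝ Subtype.val).comp e).prod ((LinearMap.funLeft ℝ ℝ Subtype.val).comp f)
  have hker : LinearMap.ker g ≠ ⊥ := LinearMap.ker_ne_bot_of_finrank_lt (by simpa using hcard)
  obtain ⟨x, hx, hx0⟩ := Submodule.exists_mem_ne_zero_of_ne_bot hker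
  rw [LinearMap.mem_ker, Prod.ext_iff] at hx
  have hxe : ∀ i, s < a i → e x i = 0 := fun i hi => congrFun hx.1 ⟨i, hi⟩
  have hxf : ∀ j, b j < t → f x j = 0 := fun j hj => congrFun hx.2 ⟨j, hj⟩
  have hpos : 0 < ∑ i, e x i ^ 2 := by
    obtain ⟨i, hi⟩ := Function.ne_iff.1 ((map_ne_zero_iff e he).2 hx0)
    exact Finset.sum_pos' (fun i _ => sq_nonneg _) ⟨i, Finset.mem_univ i, sq_pos_of_ne_zero hi⟩
  refine le_of_mul_le_mul_right ?_ hpos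
  calc t * ∑ i, e x i ^ 2 = ∑ j, t * f x j ^ 2 := by rw [hnorm, Finset.mul_sum]
    _ ≤ ∑ j, b j * f x j ^ 2 := Finset.sum_le_sum fun j _ => by
        rcases lt_or_ge (b j) t with h | h
        · simp [hxf j h]
        · gcongr
    _ = ∑ i, a i * e x i ^ 2 := (hform x).symm
    _ ≤ ∑ i, s * e x i ^ 2 := Finset.sum_le_sum fun i _ => by
        rcases lt_or_ge s (a i) with h | h
        · simp [hxe i h]
        · gcongr
    _ = s * ∑ i, e x i ^ 2 := by rw [Finset.mul_sum]

/-- A symmetric matrix and a positive diagonal matrix are simultaneously diagonalizable as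
quadratic forms, the weights being the eigenvalues of their quotient. -/
lemma exists_simultaneous_diagonalization {V : Type*} [Fintype V] [DecidableEq V]
    {L : Matrix V V ℝ} (hL : L.IsHermitian) {υ : V → ℝ} (hυ : ∀ v, 0 < υ v) :
    ∃ (a : V → ℝ) (e : (V → ℝ) →ₗ[ℝ] V → ℝ),
      (∀ x, ∑ v, e x v ^ 2 = ∑ v, υ v * x v ^ 2) ∧
      (∀ x, ∑ v, a v * e x v ^ 2 = x ⬝ᵥ L *ᵥ x) ∧
      (diagonal (fun v => (υ v)⁻¹) * L).charpoly = ∏ v, (X - C (a v)) := by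
  set D : Matrix V V ℝ := diagonal fun v => √(υ v) with hD
  set D' : Matrix V V ℝ := diagonal fun v => (√(υ v))⁻¹ with hD'
  have hDD' : D * D' = 1 := by
    rw [hD, hD', diagonal_mul_diagonal, ← diagonal_one]
    exact congrArg _ (funext fun v => mul_inv_cancel₀ (Real.sqrt_pos.2 (hυ v)).ne')
  have hD'D : D' * D = 1 := mul_eq_one_comm.1 hDD'
  have hinv : diagonal (fun v => (υ v)⁻¹) = D' * D' := by
    rw [hD', diagonal_mul_diagonal]
    exact congrArg _ (funext fun v => by rw [← mul_inv, Real.mul_self_sqrt (hυ v).le])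
  have hS : (D' * L * D').IsHermitian := by
    have := isHermitian_mul_mul_conjTranspose D' hL
    simpa [hD', diagonal_conjTranspose] using this
  set U : Matrix V V ℝ := ↑hS.eigenvectorUnitary with hU
  have hUU : U * Uᵀ = 1 := by
    simpa [star_eq_conjTranspose] using Unitary.coe_mul_star_self hS.eigenvectorUnitary
  have hspec : D' * L * D' = U * diagonal hS.eigenvalues * Uᵀ := by
    conv_lhs => rw [hS.spectral_theorem]
    simp [Unitary.conjStarAlgAut_apply, star_eq_conjTranspose, hU]
  obtain ⟨P, hP⟩ : ∃ P, P = Uᵀ * D := ⟨_, rfl⟩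
  have hPT : Pᵀ = D * U := by
    rw [hP, transpose_mul, transpose_transpose, hD, diagonal_transpose]
  have hυ_eq : diagonal υ = Pᵀ * P := by
    rw [hPT, hP, Matrix.mul_assoc, ← Matrix.mul_assoc U, hUU, one_mul, hD, diagonal_mul_diagonal]
    exact congrArg _ (funext fun v => (Real.mul_self_sqrt (hυ v).le).symm)
  have hL_eq : L = Pᵀ * diagonal hS.eigenvalues * P := by
    calc L = (D * D') * L * (D' * D) := by rw [hDD', hD'D, one_mul, mul_one]
      _ = D * (D' * L * D') * D := by simp only [Matrix.mul_assoc]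
      _ = D * (U * diagonal hS.eigenvalues * Uᵀ) * D := congrArg (D * · * D) hspec
      _ = _ := by rw [hPT, hP]; simp only [Matrix.mul_assoc]
  refine ⟨hS.eigenvalues, P.mulVecLin, fun x => ?_, fun x => ?_, ?_⟩
  · calc ∑ v, P.mulVecLin x v ^ 2 = (P *ᵥ x) ⬝ᵥ (P *ᵥ x) := by
          simp only [dotProduct, sq, mulVecLin_apply]
      _ = x ⬝ᵥ diagonal υ *ᵥ x := by
          rw [hυ_eq, ← mulVec_mulVec, dotProduct_mulVec x, vecMul_transpose]
      _ = ∑ v, υ v * x v ^ 2 := by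
          simp only [dotProduct, mulVec_diagonal]
          exact Finset.sum_congr rfl fun v _ => by ring
  · calc ∑ v, hS.eigenvalues v * P.mulVecLin x v ^ 2
          = (P *ᵥ x) ⬝ᵥ diagonal hS.eigenvalues *ᵥ (P *ᵥ x) := by
          simp only [dotProduct, mulVec_diagonal, mulVecLin_apply]
          exact Finset.sum_congr rfl fun v _ => by ring
      _ = x ⬝ᵥ (Pᵀ * diagonal hS.eigenvalues * P) *ᵥ x := by
          rw [← mulVec_mulVec, ← mulVec_mulVec, dotProduct_mulVec x, vecMul_transpose]
      _ = x ⬝ᵥ L *ᵥ x := congrArg (fun M => x ⬝ᵥ M *ᵥ x) hL_eq.symm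
  · rw [hinv, Matrix.mul_assoc, charpoly_mul_comm, hS.charpoly_eq]
    simp

lemma roots_prod_X_sub_C_univ {R ι : Type*} [CommRing R] [IsDomain R] [Fintype ι] (a : ι → R) :
    (∏ i, (X - C (a i))).roots = Finset.univ.val.map a := by
  rw [← roots_multiset_prod_X_sub_C (Finset.univ.val.map a), Multiset.map_map]
  rfl

/-- Two families with the same characteristic product have equally many members satisfying a
given predicate. -/
lemma card_subtype_eq_of_prod_X_sub_C_eq {R ι κ : Type*} [CommRing R] [IsDomain R]
    [Fintype ι] [Fintype κ] {a : ι → R} {b : κ → R}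
    (h : ∏ i, (X - C (a i)) = ∏ j, (X - C (b j))) (p : R → Prop) :
    Fintype.card {i // p (a i)} = Fintype.card {j // p (b j)} := by
  have hroots := congrArg roots h
  rw [roots_prod_X_sub_C_univ, roots_prod_X_sub_C_univ] at hroots
  have hcount := congrArg (Multiset.countP p) hroots
  rw [Multiset.countP_map, Multiset.countP_map] at hcount
  rw [Fintype.card_subtype, Fintype.card_subtype]
  exact hcount

lemma lapMat_isHermitian {V : Type} [Fintype V] [DecidableEq V] {ε : V → V → ℝ}
    (hsym : ∀ u v, ε u v = ε v u) : (lapMat ε).IsHermitian := by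
  refine (isHermitian_diagonal _).sub (IsHermitian.ext fun u v => ?_)
  simpa using hsym v u

lemma dotProduct_lapMat_mulVec {V : Type} [Fintype V] [DecidableEq V] (ε : V → V → ℝ)
    (x : V → ℝ) :
    x ⬝ᵥ lapMat ε *ᵥ x = ∑ u, ∑ v, ε u v * (x u ^ 2 - x u * x v) := by
  rw [lapMat, sub_mulVec, dotProduct_sub]
  simp only [dotProduct, mulVec_diagonal]
  rw [← Finset.sum_sub_distrib]
  refine Finset.sum_congr rfl fun u _ => ?_
  simp only [mulVec, dotProduct, of_apply, Finset.sum_mul, Finset.mul_sum]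
  rw [← Finset.sum_sub_distrib]
  exact Finset.sum_congr rfl fun v _ => by ring

lemma card_apply_lt_le {α : Type*} [LinearOrder α] {n : ℕ} {l : Fin n → α} (hl : Monotone l)
    (i : Fin n) : Fintype.card {j // l i < l j} ≤ n - 1 - i := by
  rw [Fintype.card_subtype, ← Fin.card_Ioi]
  exact Finset.card_le_card fun j hj => by
    simpa using hl.reflect_lt (Finset.mem_filter.1 hj).2

lemma card_lt_apply_le {α : Type*} [LinearOrder α] {n : ℕ} {l : Fin n → α} (hl : Monotone l)
    (i : Fin n) : Fintype.card {j // l j < l i} ≤ i := by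
  rw [Fintype.card_subtype, ← Fin.card_Iio]
  exact Finset.card_le_card fun j hj => by
    simpa using hl.reflect_lt (Finset.mem_filter.1 hj).2

/-- **Quotient interlacing**: the weighted Laplacian eigenvalues of a quotient weighted
graph satisfy `λᵢ ≤ μᵢ ≤ λ_{i+k}`. -/
theorem interlacing_quotient
    {V V' : Type} [Fintype V] [DecidableEq V] [Fintype V'] [DecidableEq V']
    (ε : V → V → ℝ) (hsym : ∀ u v, ε u v = ε v u)
    (hnonneg : ∀ u v, 0 ≤ ε u v) (hdiag : ∀ v, ε v v = 0)
    (υ : V → ℝ) (hυ : ∀ v, 0 < υ v)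
    (n k : ℕ) (hn : n = Fintype.card V) (hcard : Fintype.card V' + k = n)
    (q : V → V') (hq : Function.Surjective q)
    (υq : V' → ℝ) (hυq : υq = fun x => ∑ v ∈ Finset.univ.filter (fun v => q v = x), υ v)
    (εq : V' → V' → ℝ)
    (hεq : εq = fun x y => if x = y then 0 else
      ∑ u ∈ Finset.univ.filter (fun u => q u = x),
        ∑ v ∈ Finset.univ.filter (fun v => q v = y), ε u v)
    (lam : Fin n → ℝ) (hlamMono : Monotone lam)
    (hlam : (wlap ε υ).charpoly = ∏ i, (X - C (lam i)))
    (mu : Fin (n - k) → ℝ) (hmuMono : Monotone mu)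
    (hmu : (wlap εq υq).charpoly = ∏ i, (X - C (mu i))) :
    ∀ i : Fin (n - k),
      lam ⟨(i : ℕ), by have := i.2; omega⟩ ≤ mu i ∧
      mu i ≤ lam ⟨(i : ℕ) + k, by have := i.2; omega⟩ := by
  have hυq_pos : ∀ x, 0 < υq x := fun x => by
    obtain ⟨v, hv⟩ := hq x
    rw [hυq]
    exact Finset.sum_pos (fun v _ => hυ v) ⟨v, by simpa using hv⟩
  have hεq_symm : ∀ x y, εq x y = εq y x := fun x y => by
    simp only [hεq, eq_comm (a := x)]
    rw [Finset.sum_comm]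
    simp only [hsym]
  have hnorm : ∀ x : V' → ℝ, ∑ v, υ v * x (q v) ^ 2 = ∑ y, υq y * x y ^ 2 := fun x => by
    rw [hυq, ← Finset.sum_fiberwise Finset.univ q]
    refine Finset.sum_congr rfl fun y _ => ?_
    rw [Finset.sum_mul]
    refine Finset.sum_congr (by congr) fun v hv => ?_
    rw [(Finset.mem_filter.1 hv).2]
  have hform : ∀ x : V' → ℝ,
      (x ∘ q) ⬝ᵥ lapMat ε *ᵥ (x ∘ q) = x ⬝ᵥ lapMat εq *ᵥ x := fun x => by
    rw [dotProduct_lapMat_mulVec, dotProduct_lapMat_mulVec, ← Finset.sum_fiberwise Finset.univ q]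
    refine Finset.sum_congr rfl fun y _ => ?_
    simp_rw [← Finset.sum_fiberwise Finset.univ q (fun v => ε _ v * _)]
    rw [Finset.sum_comm]
    refine Finset.sum_congr rfl fun z _ => ?_
    have key : ∀ u ∈ Finset.univ.filter (fun u => q u = y),
        ∀ v ∈ Finset.univ.filter (fun v => q v = z),
        ε u v * ((x ∘ q) u ^ 2 - (x ∘ q) u * (x ∘ q) v) = ε u v * (x y ^ 2 - x y * x z) :=
      fun u hu v hv => by
        simp only [Function.comp_apply, (Finset.mem_filter.1 hu).2, (Finset.mem_filter.1 hv).2]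
    rw [Finset.sum_congr rfl fun u hu => Finset.sum_congr rfl (key u hu)]
    simp only [← Finset.sum_mul, hεq]
    split_ifs with h
    · rw [h]
      ring
    · congr
  obtain ⟨a, e, he, hea, ha⟩ :=
    exists_simultaneous_diagonalization (lapMat_isHermitian hsym) hυ
  obtain ⟨b, f, hf, hfb, hb⟩ :=
    exists_simultaneous_diagonalization (lapMat_isHermitian hεq_symm) hυq_pos
  have hcount_lam := card_subtype_eq_of_prod_X_sub_C_eq (ha.symm.trans hlam)
  have hcount_mu := card_subtype_eq_of_prod_X_sub_C_eq (hb.symm.trans hmu)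
  have hf_inj : Function.Injective f := (injective_iff_map_eq_zero f).2 fun x hx => by
    have h0 : ∑ y, υq y * x y ^ 2 = 0 := by rw [← hf, hx]; simp
    rw [Finset.sum_eq_zero_iff_of_nonneg
      fun y _ => mul_nonneg (hυq_pos y).le (sq_nonneg _)] at h0
    ext y
    simpa [(hυq_pos y).ne'] using h0 y (Finset.mem_univ y)
  let g : (V' → ℝ) →ₗ[ℝ] V → ℝ := e.comp (LinearMap.funLeft ℝ ℝ q)
  have hsq : ∀ x, ∑ y, f x y ^ 2 = ∑ v, g x v ^ 2 := fun x =>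
    (hf x).trans ((hnorm x).symm.trans (he (x ∘ q)).symm)
  have hweighted : ∀ x, ∑ y, b y * f x y ^ 2 = ∑ v, a v * g x v ^ 2 := fun x =>
    (hfb x).trans ((hform x).symm.trans (hea (x ∘ q)).symm)
  have hg_inj : Function.Injective g := (injective_iff_map_eq_zero g).2 fun x hx => by
    have h0 := hsq x
    simp only [hx, Pi.zero_apply, zero_pow two_ne_zero, Finset.sum_const_zero] at h0
    rw [Finset.sum_eq_zero_iff_of_nonneg fun y _ => sq_nonneg _] at h0
    refine (map_eq_zero_iff f hf_inj).1 (funext fun y => ?_)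
    simpa using h0 y (Finset.mem_univ y)
  intro i
  have hi := i.2
  constructor
  · refine le_of_card_add_card_lt_finrank f g hf_inj b a hsq hweighted _ _ ?_
    rw [hcount_mu (mu i < ·), hcount_lam (· < lam _), Module.finrank_fintype_fun_eq_card]
    have h1 := card_apply_lt_le hmuMono i
    have h2 := card_lt_apply_le hlamMono ⟨i, by omega⟩
    simp only at h1 h2
    omega
  · refine le_of_card_add_card_lt_finrank g f hg_inj a b (fun x => (hsq x).symm)
      (fun x => (hweighted x).symm) _ _ ?_
    rw [hcount_mu (· < mu i), hcount_lam (lam _ < ·), Module.finrank_fintype_fun_eq_card]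
    have h1 := card_lt_apply_le hmuMono i
    have h2 := card_apply_lt_le hlamMono ⟨i + k, by omega⟩
    simp only at h1 h2
    omega
end
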